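/- arXiv:2601.06476 — 3 statements merged into one kernel-verified Lean document; each statement's English description precedes it below -/
import Mathlib

section
/- Let f ∈ ℂ[X₀,X₁,X₂,X₃] be a homogeneous polynomial of degree 3 such that the partial derivatives ∂f/∂X₀, ∂f/∂X₁, ∂f/∂X₂, ∂f/∂X₃ have no common zero in ℂ⁴ other than the origin (i.e., f defines a nonsingular cubic surface in ℙ³). Then there exists a ℂ-algebra automorphism φ of ℂ[X₀,X₁,X₂,X₃] (given by an invertible linear change of variables) such that the leading monomial of φ(f) with respect to the degree reverse lexicographic order with X₀ > X₁ > X₂ > X₃ is X₀X₁X₂; in particular φ(f) has a squarefree leading monomial. -/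
open MvPolynomial

/-- The degree reverse lexicographic order on exponent vectors in `n` variables,
where `ord j` is the variable in position `j` (position `0` = greatest variable).
`u` is smaller than `v` iff `u` has smaller total degree, or the degrees agree and the
last nonzero entry of the vector of differences `u - v` (entries listed according to the
variable order) is positive. -/
def DegRevLexLT {n : ℕ} (ord : Fin n → Fin n) (u v : Fin n →₀ ℕ) : Prop :=
  (∑ i, u i) < (∑ i, v i) ∨
    ((∑ i, u i) = (∑ i, v i) ∧
      ∃ j : Fin n, v (ord j) < u (ord j) ∧ ∀ k : Fin n, j < k → u (ord k) = v (ord k))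

/-- `d` is the leading monomial of `f` with respect to the strict order `lt` on
exponent vectors: `d` occurs in `f` and dominates every other exponent in the support. -/
def IsLeadingMonomial {n : ℕ} {R : Type*} [CommSemiring R]
    (lt : (Fin n →₀ ℕ) → (Fin n →₀ ℕ) → Prop) (f : MvPolynomial (Fin n) R)
    (d : Fin n →₀ ℕ) : Prop :=
  d ∈ f.support ∧ ∀ e ∈ f.support, e ≠ d → lt e d

/-- The trilinear form attached to a tensor. -/
def triForm {S : Type*} [CommRing S] (τ : Fin 4 → Fin 4 → Fin 4 → S) (u v w : Fin 4 → S) : S :=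
  ∑ i, ∑ j, ∑ k, τ i j k * u i * v j * w k

theorem triForm_map {S S' : Type*} [CommRing S] [CommRing S'] (φ : S →+* S')
    (τ : Fin 4 → Fin 4 → Fin 4 → S) (u v w : Fin 4 → S) :
    φ (triForm τ u v w) = triForm (fun i j k => φ (τ i j k)) (fun i => φ (u i))
      (fun i => φ (v i)) (fun i => φ (w i)) := by
  simp [triForm, map_sum]

section triForm
variable {S : Type*} [CommRing S] (τ : Fin 4 → Fin 4 → Fin 4 → S)

theorem triForm_sum₁ {ι : Type*} (s : Finset ι) (y : ι → S) (m : ι → Fin 4 → S) (v w : Fin 4 → S) :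
    triForm τ (fun i => ∑ l ∈ s, y l * m l i) v w = ∑ l ∈ s, y l * triForm τ (m l) v w := by
  simp only [triForm, Finset.mul_sum, Finset.sum_mul]
  refine (Finset.sum_comm.trans (Finset.sum_congr rfl fun i _ => Finset.sum_comm.trans
    (Finset.sum_congr rfl fun j _ => Finset.sum_comm.trans (Finset.sum_congr rfl fun k _ => 
      Finset.sum_congr rfl fun l _ => ?_)))).symm
  ring

theorem triForm_sum₂ {ι : Type*} (s : Finset ι) (y : ι → S) (m : ι → Fin 4 → S) (u w : Fin 4 → S) :
    triForm τ u (fun i => ∑ l ∈ s, y l * m l i) w = ∑ l ∈ s, y l * triForm τ u (m l) w := by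
  simp only [triForm, Finset.mul_sum, Finset.sum_mul]
  refine (Finset.sum_comm.trans (Finset.sum_congr rfl fun i _ => Finset.sum_comm.trans
    (Finset.sum_congr rfl fun j _ => Finset.sum_comm.trans (Finset.sum_congr rfl fun k _ => 
      Finset.sum_congr rfl fun l _ => ?_)))).symm
  ring

theorem triForm_sum₃ {ι : Type*} (s : Finset ι) (y : ι → S) (m : ι → Fin 4 → S) (u v : Fin 4 → S) :
    triForm τ u v (fun i => ∑ l ∈ s, y l * m l i) = ∑ l ∈ s, y l * triForm τ u v (m l) := by
  simp only [triForm, Finset.mul_sum]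
  refine (Finset.sum_comm.trans (Finset.sum_congr rfl fun i _ => Finset.sum_comm.trans
    (Finset.sum_congr rfl fun j _ => Finset.sum_comm.trans (Finset.sum_congr rfl fun k _ => 
      Finset.sum_congr rfl fun l _ => ?_)))).symm
  ring

theorem triForm_lin₁ (x y : S) (a b v w : Fin 4 → S) :
    triForm τ (x • a + y • b) v w = x * triForm τ a v w + y * triForm τ b v w := by
  have h := triForm_sum₁ τ Finset.univ ![x, y] ![a, b] v w
  simp only [Fin.sum_univ_two, Matrix.cons_val_zero, Matrix.cons_val_one] at h
  exact h

theorem triForm_lin₂ (x y : S) (a b u w : Fin 4 → S) :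
    triForm τ u (x • a + y • b) w = x * triForm τ u a w + y * triForm τ u b w := by
  have h := triForm_sum₂ τ Finset.univ ![x, y] ![a, b] u w
  simp only [Fin.sum_univ_two, Matrix.cons_val_zero, Matrix.cons_val_one] at h
  exact h

theorem triForm_lin₃ (x y : S) (a b u v : Fin 4 → S) :
    triForm τ u v (x • a + y • b) = x * triForm τ u v a + y * triForm τ u v b := by
  have h := triForm_sum₃ τ Finset.univ ![x, y] ![a, b] u v
  simp only [Fin.sum_univ_two, Matrix.cons_val_zero, Matrix.cons_val_one] at h
  exact h

theorem triForm_swap₁₂ (h : ∀ i j k, τ i j k = τ j i k) (u v w : Fin 4 → S) :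
    triForm τ u v w = triForm τ v u w := by
  rw [triForm, triForm, Finset.sum_comm]
  refine Finset.sum_congr rfl fun i _ => Finset.sum_congr rfl fun j _ =>
    Finset.sum_congr rfl fun k _ => ?_
  rw [h]; ring

theorem triForm_swap₂₃ (h : ∀ i j k, τ i j k = τ i k j) (u v w : Fin 4 → S) :
    triForm τ u v w = triForm τ u w v := by
  rw [triForm, triForm]
  refine Finset.sum_congr rfl fun i _ => Finset.sum_comm.trans ?_
  refine Finset.sum_congr rfl fun j _ => Finset.sum_congr rfl fun k _ => ?_
  rw [h]; ring

theorem triForm_add_tensor (t : S) (δ : Fin 4 → Fin 4 → Fin 4 → S) (u v w : Fin 4 → S) :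
    triForm (fun i j k => τ i j k + t * δ i j k) u v w = triForm τ u v w + t * triForm δ u v w := by
  simp only [triForm, Finset.mul_sum, ← Finset.sum_add_distrib]
  refine Finset.sum_congr rfl fun i _ => Finset.sum_congr rfl fun j _ =>
    Finset.sum_congr rfl fun k _ => ?_
  ring

/-- A cubic form restricted to a line, expanded. -/
theorem triForm_cubic (h1 : ∀ i j k, τ i j k = τ j i k) (h2 : ∀ i j k, τ i j k = τ i k j)
    (x y : S) (a b : Fin 4 → S) :
    triForm τ (x • a + y • b) (x • a + y • b) (x • a + y • b) =
      x ^ 3 * triForm τ a a a + x ^ 2 * y * (3 * triForm τ a a b) +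
      x * y ^ 2 * (3 * triForm τ a b b) + y ^ 3 * triForm τ b b b := by
  simp only [triForm_lin₁, triForm_lin₂, triForm_lin₃]
  rw [triForm_swap₂₃ τ h2 a b a, triForm_swap₁₂ τ h1 b a a, triForm_swap₂₃ τ h2 a b a,
    triForm_swap₂₃ τ h2 b b a, triForm_swap₁₂ τ h1 b a b]
  ring
end triForm
theorem exists_tensor (f : MvPolynomial (Fin 4) ℂ) (hf : f.IsHomogeneous 3) :
    ∃ τ : Fin 4 → Fin 4 → Fin 4 → ℂ, (∀ i j k, τ i j k = τ j i k) ∧ (∀ i j k, τ i j k = τ i k j) ∧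
      f = triForm (fun i j k => C (τ i j k)) X X X ∧
      ∀ i, pderiv i f = 3 * ∑ j, ∑ k, C (τ i j k) * X j * X k := by
  have comm : ∀ i j (p : MvPolynomial (Fin 4) ℂ), pderiv i (pderiv j p) = pderiv j (pderiv i p) := by
    intro i j p
    have h : ⁅(pderiv i : Derivation ℂ (MvPolynomial (Fin 4) ℂ) (MvPolynomial (Fin 4) ℂ)),
        (pderiv j : Derivation ℂ (MvPolynomial (Fin 4) ℂ) (MvPolynomial (Fin 4) ℂ))⁆ = 0 := by
      apply MvPolynomial.derivation_ext
      intro k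
      rw [Derivation.commutator_apply]
      simp only [pderiv_X, Derivation.zero_apply, Pi.single_apply]
      split_ifs <;> simp
    have := congrArg (fun D => D p) h
    simp only [Derivation.commutator_apply, Derivation.zero_apply] at this
    exact sub_eq_zero.mp this
  have h3 : ∀ i j k, ∃ c : ℂ, pderiv k (pderiv j (pderiv i f)) = C c := by
    intro i j k
    have h := ((hf.pderiv (i := i)).pderiv (i := j)).pderiv (i := k)
    simp only [Nat.reduceSub] at h
    rw [← totalDegree_zero_iff_isHomogeneous, totalDegree_eq_zero_iff_eq_C] at h
    exact ⟨_, h⟩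
  choose t ht using h3
  have e2 : ∀ i j, pderiv j (pderiv i f) = ∑ k, X k * C (t i j k) := by
    intro i j
    have h := ((hf.pderiv (i := i)).pderiv (i := j)).sum_X_mul_pderiv
    simp only [ht, Nat.reduceSub, one_smul] at h
    exact h.symm
  have e1 : ∀ i, (2 : ℂ) • pderiv i f = ∑ j, X j * ∑ k, X k * C (t i j k) := by
    intro i
    have h := (hf.pderiv (i := i)).sum_X_mul_pderiv
    simp only [e2, Nat.reduceSub] at h
    rw [h, ← Nat.cast_smul_eq_nsmul ℂ]; norm_num
  have e0 : (3 : ℂ) • f = ∑ i, X i * pderiv i f := by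
    rw [hf.sum_X_mul_pderiv, ← Nat.cast_smul_eq_nsmul ℂ]; norm_num
  have e1' : ∀ i, pderiv i f = 3 * ∑ j, ∑ k, C (t i j k / 6) * X j * X k := by
    intro i
    have : pderiv i f = (1/2 : ℂ) • ((2 : ℂ) • pderiv i f) := by rw [smul_smul]; norm_num
    rw [this, e1, smul_eq_C_mul, Finset.mul_sum, Finset.mul_sum]
    refine Finset.sum_congr rfl fun j _ => ?_
    rw [Finset.mul_sum, Finset.mul_sum, Finset.mul_sum]
    refine Finset.sum_congr rfl fun k _ => ?_
    have h6 : (C (t i j k) : MvPolynomial (Fin 4) ℂ) = 6 * C (t i j k / 6) := by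
      rw [show (6 : MvPolynomial (Fin 4) ℂ) = C 6 from (map_ofNat C 6).symm, ← C_mul]
      congr 1; ring
    have h2 : (C (1/2 : ℂ) : MvPolynomial (Fin 4) ℂ) * 2 = 1 := by
      rw [show (2 : MvPolynomial (Fin 4) ℂ) = C 2 from (map_ofNat C 2).symm, ← C_mul, ← C_1]
      congr 1; norm_num
    rw [h6]
    linear_combination (3 * X j * X k * C (t i j k / 6)) * h2
  refine ⟨fun i j k => t i j k / 6, ?_, ?_, ?_, e1'⟩
  · intro i j k
    have : (C (t i j k) : MvPolynomial (Fin 4) ℂ) = C (t j i k) := by rw [← ht, ← ht, comm j i]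
    simp only [C_injective _ _ this]
  · intro i j k
    have : (C (t i j k) : MvPolynomial (Fin 4) ℂ) = C (t i k j) := by rw [← ht, ← ht, comm j k]
    simp only [C_injective _ _ this]
  · have : f = (1/3 : ℂ) • ((3 : ℂ) • f) := by rw [smul_smul]; norm_num
    rw [this, e0, smul_eq_C_mul, Finset.mul_sum, triForm]
    refine Finset.sum_congr rfl fun i _ => ?_
    rw [e1']
    have h2 : (C (1/3 : ℂ) : MvPolynomial (Fin 4) ℂ) * 3 = 1 := by
      rw [show (3 : MvPolynomial (Fin 4) ℂ) = C 3 from (map_ofNat C 3).symm, ← C_mul, ← C_1]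
      congr 1; norm_num
    have : C (1/3 : ℂ) * (X i * (3 * ∑ j, ∑ k, C (t i j k / 6) * X j * X k)) =
      X i * ∑ j, ∑ k, C (t i j k / 6) * X j * X k := by linear_combination (X i * ∑ j, ∑ k, C (t i j k / 6) * X j * X k) * h2
    rw [this]
    simp only [Finset.mul_sum]
    refine Finset.sum_congr rfl fun j _ => Finset.sum_congr rfl fun k _ => by ring
theorem finite_or_cocountable {σ : Type} [Finite σ] (I : Ideal (MvPolynomial σ ℂ))
    (p : MvPolynomial σ ℂ) (T : Set ℂ) (hT : T = {t | ∃ x ∈ zeroLocus ℂ I, eval x p = t})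
    (hinf : T.Infinite) : Tᶜ.Countable := by
  classical
  have hu : ∀ t : (Tᶜ : Set ℂ), ∃ v : MvPolynomial σ ℂ ⧸ I,
      v * (Ideal.Quotient.mk I p - algebraMap ℂ _ t.1) = 1 := by
    rintro ⟨t, ht⟩
    have h1 : I ⊔ Ideal.span {p - C t} = ⊤ := by
      rw [← Ideal.radical_eq_top, ← vanishingIdeal_zeroLocus_eq_radical (K := ℂ)]
      convert vanishingIdeal_empty
      rw [Set.eq_empty_iff_forall_notMem]
      intro x hx
      apply ht
      rw [hT]
      refine ⟨x, zeroLocus_anti_mono le_sup_left hx, ?_⟩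
      have := mem_zeroLocus_iff.1 hx (p - C t) (Ideal.mem_sup_right (Ideal.mem_span_singleton_self _))
      simpa [sub_eq_zero, aeval_eq_eval] using this
    obtain ⟨a, ha, b, hb, hab⟩ := Submodule.mem_sup.1 ((Ideal.eq_top_iff_one _).1 h1)
    obtain ⟨w, rfl⟩ := Ideal.mem_span_singleton'.1 hb
    refine ⟨Ideal.Quotient.mk I w, ?_⟩
    have : algebraMap ℂ (MvPolynomial σ ℂ ⧸ I) t = Ideal.Quotient.mk I (C t) := rfl
    rw [this, ← map_sub, ← map_mul, ← map_one (Ideal.Quotient.mk I), ← hab, map_add,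
      Ideal.Quotient.eq_zero_iff_mem.2 ha, zero_add]
  choose v hv using hu
  have hli : LinearIndependent ℂ v := by
    rw [linearIndependent_iff']
    intro s g hg i hi
    let P : Polynomial ℂ := ∑ i ∈ s, Polynomial.C (g i) * ∏ j ∈ s.erase i, (Polynomial.X - Polynomial.C j.1)
    have hP : Polynomial.aeval (Ideal.Quotient.mk I p) P = 0 := by
      have : Polynomial.aeval (Ideal.Quotient.mk I p) P =
        (∑ i ∈ s, g i • v i) * ∏ j ∈ s, (Ideal.Quotient.mk I p - algebraMap ℂ _ j.1) := by
        rw [Finset.sum_mul, map_sum]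
        refine Finset.sum_congr rfl fun i hi => ?_
        rw [← Finset.mul_prod_erase s _ hi, map_mul, map_prod, Polynomial.aeval_C]
        simp only [map_sub, Polynomial.aeval_X, Polynomial.aeval_C]
        rw [show g i • v i = algebraMap ℂ (MvPolynomial σ ℂ ⧸ I) (g i) * v i by
          obtain ⟨w, hw⟩ := Ideal.Quotient.mk_surjective (v i)
          rw [← hw]
          change Ideal.Quotient.mk I (g i • w) = Ideal.Quotient.mk I (C (g i)) * Ideal.Quotient.mk I w
          rw [smul_eq_C_mul, map_mul]]
        linear_combination (- algebraMap ℂ (MvPolynomial σ ℂ ⧸ I) (g i) * ∏ j ∈ s.erase i, (Ideal.Quotient.mk I p - algebraMap ℂ _ j.1)) * hv i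
      rw [this, hg, zero_mul]
    have hPI : Polynomial.aeval p P ∈ I := by
      rw [← Ideal.Quotient.eq_zero_iff_mem, ← hP]
      exact (Polynomial.aeval_algHom_apply (Ideal.Quotient.mkₐ ℂ I) p P).symm
    have hP0 : P = 0 := by
      apply Polynomial.eq_zero_of_infinite_isRoot
      refine hinf.mono ?_
      intro t ht
      rw [hT] at ht
      obtain ⟨x, hx, rfl⟩ := ht
      have := mem_zeroLocus_iff.1 hx _ hPI
      rw [← Polynomial.aeval_algHom_apply] at this
      simpa [Polynomial.IsRoot, aeval_eq_eval, Polynomial.aeval_def, Polynomial.eval₂_eq_eval_map] using this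
    have h1 : Polynomial.eval i.1 P = 0 := by rw [hP0]; simp
    simp only [P, Polynomial.eval_finsetSum, Polynomial.eval_mul, Polynomial.eval_C,
      Polynomial.eval_prod, Polynomial.eval_sub, Polynomial.eval_X] at h1
    rw [Finset.sum_eq_single_of_mem i hi] at h1
    · rcases mul_eq_zero.1 h1 with h | h
      · exact h
      · obtain ⟨j, hj, hj0⟩ := Finset.prod_eq_zero_iff.1 h
        exact absurd (Subtype.ext (sub_eq_zero.1 hj0)).symm (Finset.ne_of_mem_erase hj)
    · intro j _ hji
      apply mul_eq_zero_of_right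
      apply Finset.prod_eq_zero (Finset.mem_erase.2 ⟨hji.symm, hi⟩)
      simp
  have hr := hli.cardinal_le_rank
  have hr2 : Module.rank ℂ (MvPolynomial σ ℂ ⧸ I) ≤ Module.rank ℂ (MvPolynomial σ ℂ) :=
    (Ideal.Quotient.mkₐ ℂ I).toLinearMap.rank_le_of_surjective Ideal.Quotient.mk_surjective
  rw [← Cardinal.le_aleph0_iff_set_countable]
  refine hr.trans (hr2.trans ?_)
  rw [MvPolynomial.rank_eq_lift]
  simp
/-- The tensor of the model cubic `X₀² X₂ + X₁² X₃`. -/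
noncomputable def modelTensor (i j k : Fin 4) : ℂ :=
  if (i = 0 ∧ j = 0 ∧ k = 2) ∨ (i = 0 ∧ j = 2 ∧ k = 0) ∨ (i = 2 ∧ j = 0 ∧ k = 0) ∨
    (i = 1 ∧ j = 1 ∧ k = 3) ∨ (i = 1 ∧ j = 3 ∧ k = 1) ∨ (i = 3 ∧ j = 1 ∧ k = 1) then 1 / 3 else 0

theorem triForm_model (u v w : Fin 4 → ℂ) : triForm modelTensor u v w =
    1 / 3 * (u 0 * v 0 * w 2 + u 0 * v 2 * w 0 + u 2 * v 0 * w 0 +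
      u 1 * v 1 * w 3 + u 1 * v 3 * w 1 + u 3 * v 1 * w 1) := by
  simp [triForm, modelTensor, Fin.sum_univ_four]
  ring

theorem model_symm₁ (i j k : Fin 4) : modelTensor i j k = modelTensor j i k := by
  unfold modelTensor
  refine if_congr ?_ rfl rfl
  revert i j k; decide

theorem model_symm₂ (i j k : Fin 4) : modelTensor i j k = modelTensor i k j := by
  unfold modelTensor
  refine if_congr ?_ rfl rfl
  revert i j k; decide

/-- Two points spanning the line with chart coordinates `u`. -/
def ptA {S : Type*} [CommRing S] (u : Fin 4 → S) : Fin 4 → S := ![1, 0, u 0, u 2]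
def ptB {S : Type*} [CommRing S] (u : Fin 4 → S) : Fin 4 → S := ![0, 1, u 1, u 3]

/-- The four coefficients of a cubic restricted to the line with chart coordinates `u`. -/
def lineEq {S : Type*} [CommRing S] (τ : Fin 4 → Fin 4 → Fin 4 → S) (u : Fin 4 → S) : Fin 4 → S :=
  ![triForm τ (ptA u) (ptA u) (ptA u), 3 * triForm τ (ptA u) (ptA u) (ptB u),
    3 * triForm τ (ptA u) (ptB u) (ptB u), triForm τ (ptB u) (ptB u) (ptB u)]

theorem lineEq_model (u : Fin 4 → ℂ) : lineEq modelTensor u = u := by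
  funext k
  fin_cases k <;> simp [lineEq, triForm_model, ptA, ptB] <;> ring

theorem lineEq_map {S S' : Type*} [CommRing S] [CommRing S'] (φ : S →+* S')
    (τ : Fin 4 → Fin 4 → Fin 4 → S) (u : Fin 4 → S) (k : Fin 4) :
    φ (lineEq τ u k) = lineEq (fun i j k => φ (τ i j k)) (fun i => φ (u i)) k := by
  have hA : (fun i => φ (ptA u i)) = ptA (fun i => φ (u i)) := by
    funext i; fin_cases i <;> simp [ptA]
  have hB : (fun i => φ (ptB u i)) = ptB (fun i => φ (u i)) := by
    funext i; fin_cases i <;> simp [ptB]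
  have h3 : φ 3 = 3 := map_ofNat φ 3
  fin_cases k <;> simp [lineEq, triForm_map, hA, hB, h3]

theorem lineEq_add (τ δ : Fin 4 → Fin 4 → Fin 4 → ℂ) (t : ℂ) (u : Fin 4 → ℂ) :
    lineEq (fun i j k => τ i j k + t * δ i j k) u = lineEq τ u + t • lineEq δ u := by
  funext k
  fin_cases k <;> simp [lineEq, triForm_add_tensor] <;> ring

theorem contDiff_lineEq (δ : Fin 4 → Fin 4 → Fin 4 → ℂ) : ContDiff ℂ 1 (lineEq δ) := by
  have hA : ∀ i, ContDiff ℂ 1 (fun u : Fin 4 → ℂ => ptA u i) := by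
    intro i; fin_cases i <;> simp [ptA] <;> fun_prop
  have hB : ∀ i, ContDiff ℂ 1 (fun u : Fin 4 → ℂ => ptB u i) := by
    intro i; fin_cases i <;> simp [ptB] <;> fun_prop
  rw [contDiff_pi]
  intro k
  fin_cases k <;> simp [lineEq, triForm] <;> fun_prop

/-- Parameters of the pencil for which the cubic has a line in the chart. -/
def goodParams (δ : Fin 4 → Fin 4 → Fin 4 → ℂ) : Set ℂ :=
  {t | ∃ u : Fin 4 → ℂ, lineEq (fun i j k => modelTensor i j k + t * δ i j k) u = 0}

theorem goodParams_infinite (δ : Fin 4 → Fin 4 → Fin 4 → ℂ) : (goodParams δ).Infinite := by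
  let Ψ : ℂ × (Fin 4 → ℂ) → ℂ × (Fin 4 → ℂ) := fun z => (z.1, z.2 + z.1 • lineEq δ z.2)
  let D : ℂ × (Fin 4 → ℂ) →L[ℂ] ℂ × (Fin 4 → ℂ) :=
    (ContinuousLinearMap.fst ℂ ℂ (Fin 4 → ℂ)).prod (ContinuousLinearMap.snd ℂ ℂ (Fin 4 → ℂ) +
      (ContinuousLinearMap.fst ℂ ℂ (Fin 4 → ℂ)).smulRight (lineEq δ 0))
  have hD : HasStrictFDerivAt Ψ D 0 := by
    have h1 : HasStrictFDerivAt (fun z : ℂ × (Fin 4 → ℂ) => z.1)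
      (ContinuousLinearMap.fst ℂ ℂ (Fin 4 → ℂ)) 0 := hasStrictFDerivAt_fst
    have h2 : HasStrictFDerivAt (fun z : ℂ × (Fin 4 → ℂ) => z.2)
      (ContinuousLinearMap.snd ℂ ℂ (Fin 4 → ℂ)) 0 := hasStrictFDerivAt_snd
    have h3 : HasStrictFDerivAt (fun z : ℂ × (Fin 4 → ℂ) => lineEq δ z.2)
        (fderiv ℂ (fun z : ℂ × (Fin 4 → ℂ) => lineEq δ z.2) 0) 0 :=
      (((contDiff_lineEq δ).comp contDiff_snd).contDiffAt).hasStrictFDerivAt one_ne_zero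
    have h := h1.prodMk (h2.add (h1.smul h3))
    refine HasStrictFDerivAt.congr_fderiv (f := Ψ) h ?_
    refine ContinuousLinearMap.ext fun z => ?_
    simp [D]
  have hsurj : D.range = ⊤ := by
    rw [LinearMap.range_eq_top]
    rintro ⟨t, w⟩
    refine ⟨(t, w - t • lineEq δ 0), ?_⟩
    simp [D]
  have hm := hD.map_nhds_eq_of_surj hsurj
  have h0 : Ψ 0 = 0 := by simp [Ψ]
  rw [h0] at hm
  have hr : Set.range Ψ ∈ nhds (0 : ℂ × (Fin 4 → ℂ)) := by
    rw [← hm]; exact Filter.mem_map.2 (by simp)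
  have hc : Filter.Tendsto (fun t : ℂ => ((t, 0) : ℂ × (Fin 4 → ℂ))) (nhds 0) (nhds 0) := by
    have : Continuous (fun t : ℂ => ((t, 0) : ℂ × (Fin 4 → ℂ))) := by fun_prop
    exact this.tendsto 0
  refine infinite_of_mem_nhds 0 (Filter.mem_of_superset (hc hr) ?_)
  rintro t ⟨⟨s, u⟩, hz⟩
  simp only [Ψ, Prod.mk.injEq] at hz
  obtain ⟨rfl, hz⟩ := hz
  exact ⟨u, by rw [lineEq_add, lineEq_model]; exact hz⟩

theorem goodParams_cocountable (δ : Fin 4 → Fin 4 → Fin 4 → ℂ) : (goodParams δ)ᶜ.Countable := by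
  let P : Fin 4 → MvPolynomial (Fin 5) ℂ :=
    lineEq (fun i j k => C (modelTensor i j k) + X 0 * C (δ i j k)) (fun i => X i.succ)
  have hP : ∀ x k, eval x (P k) =
      lineEq (fun i j k => modelTensor i j k + x 0 * δ i j k) (fun i => x i.succ) k := by
    intro x k
    simp only [P]
    rw [lineEq_map]
    simp
  refine finite_or_cocountable (Ideal.span (Set.range P)) (X 0) _ ?_ (goodParams_infinite δ)
  ext t
  simp only [goodParams, Set.mem_ofPred_eq, zeroLocus_span, Set.forall_mem_range, aeval_eq_eval, eval_X]
  constructor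
  · rintro ⟨u, hu⟩
    refine ⟨Fin.cons t u, ?_, by simp⟩
    intro k
    have := hP (Fin.cons t u) k
    simp only [Fin.cons_zero, Fin.cons_succ] at this
    simpa [hu] using this
  · rintro ⟨x, hx, rfl⟩
    refine ⟨fun i => x i.succ, ?_⟩
    funext k
    rw [← hP]
    simpa using hx k
theorem isClosed_lineParams (F : ℂ → (Fin 4 → ℂ) → ℂ)
    (hFc : Continuous (fun z : ℂ × (Fin 4 → ℂ) => F z.1 z.2)) :
    IsClosed {t : ℂ | ∃ a b : Fin 4 → ℂ, LinearIndependent ℂ ![a, b] ∧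
      ∀ x y : ℂ, F t (x • a + y • b) = 0} := by
  let E := EuclideanSpace ℂ (Fin 4)
  let O : Set (E × E) := {z | ‖z.1‖ = 1 ∧ ‖z.2‖ = 1 ∧ inner ℂ z.1 z.2 = 0}
  have hO : IsCompact O := by
    apply IsCompact.of_isClosed_subset (isCompact_closedBall (0 : E × E) 1)
    · refine (isClosed_eq (by fun_prop) (by fun_prop)).inter
        ((isClosed_eq (by fun_prop) (by fun_prop)).inter (isClosed_eq (by fun_prop) (by fun_prop)))
    · rintro ⟨a, b⟩ ⟨ha, hb, -⟩
      simp only at ha hb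
      simp [Prod.norm_def, ha, hb]
  have : CompactSpace O := isCompact_iff_compactSpace.1 hO
  let Z : Set (ℂ × O) := {z | ∀ x y : ℂ, F z.1 (x • (z.2.1.1 : Fin 4 → ℂ) + y • (z.2.1.2 : Fin 4 → ℂ)) = 0}
  have hZ : IsClosed Z := by
    have hZ' : Z = ⋂ x : ℂ, ⋂ y : ℂ, {z | F z.1 (x • (z.2.1.1 : Fin 4 → ℂ) + y • (z.2.1.2 : Fin 4 → ℂ)) = 0} := by
      ext z; simp [Z]
    rw [hZ']
    refine isClosed_iInter fun x => isClosed_iInter fun y => ?_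
    have c0 : Continuous (fun e : E => (e : Fin 4 → ℂ)) := PiLp.continuous_ofLp 2 _
    have c1 : Continuous (fun z : ℂ × O => (z.2.1.1 : Fin 4 → ℂ)) :=
      c0.comp (continuous_fst.comp (continuous_subtype_val.comp continuous_snd))
    have c2 : Continuous (fun z : ℂ × O => (z.2.1.2 : Fin 4 → ℂ)) :=
      c0.comp (continuous_snd.comp (continuous_subtype_val.comp continuous_snd))
    have c3 : Continuous (fun z : ℂ × O => (z.1, x • (z.2.1.1 : Fin 4 → ℂ) + y • (z.2.1.2 : Fin 4 → ℂ))) :=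
      continuous_fst.prodMk ((c1.const_smul x).add (c2.const_smul y))
    exact isClosed_eq (hFc.comp c3) continuous_const
  have hcl : IsClosed (Prod.fst '' Z) := isClosedMap_fst_of_compactSpace _ hZ
  convert hcl using 1
  refine Set.Subset.antisymm ?_ ?_
  · rintro t ⟨a, b, hli, hvan⟩
    let V : Fin 2 → E := ![WithLp.toLp 2 (a), WithLp.toLp 2 (b)]
    have hV : LinearIndependent ℂ V := by
      rw [LinearIndependent.pair_iff] at hli ⊢
      intro s t hst
      apply hli s t
      funext i
      exact congrArg (fun z : E => z i) hst
    have hon := InnerProductSpace.gramSchmidtNormed_orthonormal (𝕜 := ℂ) hV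
    set W := InnerProductSpace.gramSchmidtNormed ℂ V with hW
    have hmem : ∀ i, ∃ x y : ℂ, (W i : Fin 4 → ℂ) = x • a + y • b := by
      intro i
      have h : W i ∈ Submodule.span ℂ (Set.range V) := by
        rw [← InnerProductSpace.span_gramSchmidt ℂ V, ← InnerProductSpace.span_gramSchmidtNormed_range]
        exact Submodule.subset_span ⟨i, rfl⟩
      simp only [V, Matrix.range_cons, Matrix.range_empty, Set.union_empty, Set.singleton_union] at h
      obtain ⟨x, y, h⟩ := Submodule.mem_span_pair.1 h
      refine ⟨x, y, ?_⟩
      rw [← h]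
      rfl
    refine ⟨(t, ⟨(W 0, W 1), hon.1 0, hon.1 1, hon.2 (by decide)⟩), ?_, rfl⟩
    intro x y
    obtain ⟨p, q, hpq⟩ := hmem 0
    obtain ⟨r, s, hrs⟩ := hmem 1
    simp only [hpq, hrs]
    rw [← hvan (x * p + y * r) (x * q + y * s)]
    congr 1
    module
  · rintro _ ⟨⟨t, ⟨a, b⟩, ha, hb, hab⟩, hz, rfl⟩
    refine ⟨a, b, ?_, hz⟩
    have hon : Orthonormal ℂ ![a, b] := by
      refine ⟨?_, ?_⟩
      · intro i; fin_cases i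
        · exact ha
        · exact hb
      · intro i j hij
        fin_cases i <;> fin_cases j
        · exact absurd rfl hij
        · exact hab
        · exact inner_eq_zero_symm.1 hab
        · exact absurd rfl hij
    have hli := hon.linearIndependent
    rw [LinearIndependent.pair_iff] at hli ⊢
    intro s t hst
    apply hli s t
    ext i
    exact congrFun hst i

theorem exists_line (τ : Fin 4 → Fin 4 → Fin 4 → ℂ) (h1 : ∀ i j k, τ i j k = τ j i k)
    (h2 : ∀ i j k, τ i j k = τ i k j) :
    ∃ a b : Fin 4 → ℂ, LinearIndependent ℂ ![a, b] ∧
      ∀ x y : ℂ, triForm τ (x • a + y • b) (x • a + y • b) (x • a + y • b) = 0 := by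
  let δ : Fin 4 → Fin 4 → Fin 4 → ℂ := fun i j k => τ i j k - modelTensor i j k
  let F : ℂ → (Fin 4 → ℂ) → ℂ := fun t v =>
    triForm (fun i j k => modelTensor i j k + t * δ i j k) v v v
  have hF1 : ∀ v, F 1 v = triForm τ v v v := by intro v; simp [F, δ]
  have hFc : Continuous (fun z : ℂ × (Fin 4 → ℂ) => F z.1 z.2) := by
    simp only [F, triForm]; fun_prop
  have hcl := isClosed_lineParams F hFc
  have hsub : goodParams δ ⊆ {t : ℂ | ∃ a b : Fin 4 → ℂ, LinearIndependent ℂ ![a, b] ∧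
      ∀ x y : ℂ, F t (x • a + y • b) = 0} := by
    rintro t ⟨u, hu⟩
    have hvan : ∀ x y : ℂ, F t (x • ptA u + y • ptB u) = 0 := by
      intro x y
      simp only [F]
      rw [triForm_cubic]
      · have e0 := congrFun hu 0
        have e1 := congrFun hu 1
        have e2 := congrFun hu 2
        have e3 := congrFun hu 3
        simp only [lineEq, Matrix.cons_val, Pi.zero_apply] at e0 e1 e2 e3
        rw [e0, e1, e2, e3]; ring
      · intro i j k; simp only [δ]; rw [h1, model_symm₁]
      · intro i j k; simp only [δ]; rw [h2, model_symm₂]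
    refine ⟨ptA u, ptB u, ?_, hvan⟩
    rw [LinearIndependent.pair_iff]
    intro s t hst
    have e0 := congrFun hst 0
    have e1 := congrFun hst 1
    simp [ptA, ptB] at e0 e1
    exact ⟨e0, e1⟩
  have hd : Dense (goodParams δ) := by
    have := (goodParams_cocountable δ).dense_compl ℂ
    rwa [compl_compl] at this
  have hall := (hd.mono hsub).closure_eq
  rw [hcl.closure_eq] at hall
  obtain ⟨a, b, hli, hz⟩ := (Set.eq_univ_iff_forall.1 hall) 1
  exact ⟨a, b, hli, fun x y => by rw [← hF1]; exact hz x y⟩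
theorem quad_root (a b c : ℂ) : ∃ x y : ℂ, (x ≠ 0 ∨ y ≠ 0) ∧ a * x ^ 2 + 2 * b * (x * y) + c * y ^ 2 = 0 := by
  by_cases ha : a = 0
  · exact ⟨1, 0, Or.inl one_ne_zero, by simp [ha]⟩
  · obtain ⟨s, hs⟩ := IsAlgClosed.exists_pow_nat_eq (b ^ 2 - a * c) (n := 2) (by norm_num)
    exact ⟨-b + s, a, Or.inr ha, by linear_combination a * hs⟩

theorem pencil (a0 a1 a2 b0 b1 b2 : ℂ)
    (h : ∀ x y : ℂ, a0 * x ^ 2 + 2 * a1 * (x * y) + a2 * y ^ 2 = 0 →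
      b0 * x ^ 2 + 2 * b1 * (x * y) + b2 * y ^ 2 = 0 → x = 0 ∧ y = 0) :
    ∃ x0 y0 x1 y1 s t s' t' : ℂ, x0 * y1 - y0 * x1 ≠ 0 ∧ s * t' - t * s' ≠ 0 ∧
      s * (a0 * x0 ^ 2 + 2 * a1 * (x0 * y0) + a2 * y0 ^ 2) +
        t * (b0 * x0 ^ 2 + 2 * b1 * (x0 * y0) + b2 * y0 ^ 2) = 0 ∧
      s * (a0 * (x0 * x1) + a1 * (x0 * y1 + x1 * y0) + a2 * (y0 * y1)) +
        t * (b0 * (x0 * x1) + b1 * (x0 * y1 + x1 * y0) + b2 * (y0 * y1)) ≠ 0 := by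
  -- it suffices to find a root with nonzero polar
  suffices H : ∃ x0 y0 x1 y1 s t : ℂ, 
      s * (a0 * x0 ^ 2 + 2 * a1 * (x0 * y0) + a2 * y0 ^ 2) +
        t * (b0 * x0 ^ 2 + 2 * b1 * (x0 * y0) + b2 * y0 ^ 2) = 0 ∧
      s * (a0 * (x0 * x1) + a1 * (x0 * y1 + x1 * y0) + a2 * (y0 * y1)) +
        t * (b0 * (x0 * x1) + b1 * (x0 * y1 + x1 * y0) + b2 * (y0 * y1)) ≠ 0 by
    obtain ⟨x0, y0, x1, y1, s, t, h1, h2⟩ := H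
    have hst : s ≠ 0 ∨ t ≠ 0 := by
      by_contra! hc
      apply h2; rw [hc.1, hc.2]; ring
    have hdet : x0 * y1 - y0 * x1 ≠ 0 := by
      intro hd
      by_cases hx : x0 = 0
      · by_cases hy : y0 = 0
        · apply h2; rw [hx, hy]; ring
        · have hx1 : x1 = 0 := by
            rw [hx] at hd
            have : y0 * x1 = 0 := by linear_combination -hd
            exact (mul_eq_zero.1 this).resolve_left hy
          apply h2
          apply mul_left_cancel₀ hy
          rw [hx, hx1]
          rw [hx] at h1
          linear_combination y1 * h1
      · apply h2
        apply mul_left_cancel₀ hx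
        have : y1 * x0 = y0 * x1 := by linear_combination hd
        linear_combination x1 * h1 + (s * (a1 * x0 + a2 * y0) + t * (b1 * x0 + b2 * y0)) * this
    rcases hst with hs | ht
    · exact ⟨x0, y0, x1, y1, s, t, 0, 1, hdet, by simpa using hs, h1, h2⟩
    · exact ⟨x0, y0, x1, y1, s, t, 1, 0, hdet, by simpa using ht, h1, h2⟩
  by_contra! hno
  -- the Jacobian vanishes
  have key : ∀ x0 y0 x1 y1 : ℂ,
      -(b0 * x0 ^ 2 + 2 * b1 * (x0 * y0) + b2 * y0 ^ 2) *
        (a0 * (x0 * x1) + a1 * (x0 * y1 + x1 * y0) + a2 * (y0 * y1)) +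
      (a0 * x0 ^ 2 + 2 * a1 * (x0 * y0) + a2 * y0 ^ 2) *
        (b0 * (x0 * x1) + b1 * (x0 * y1 + x1 * y0) + b2 * (y0 * y1)) = 0 := by
    intro x0 y0 x1 y1
    exact hno x0 y0 x1 y1 _ _ (by ring)
  have k1 : a0 * b1 - a1 * b0 = 0 := by linear_combination key 1 0 0 1
  have k2 : a1 * b2 - a2 * b1 = 0 := by linear_combination - key 0 1 1 0
  have k3 : a0 * b2 - a2 * b0 = 0 := by
    linear_combination key 1 1 0 1 - k1 - k2
  by_cases hA : a0 = 0 ∧ a1 = 0 ∧ a2 = 0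
  · obtain ⟨x, y, hxy, hr⟩ := quad_root b0 b1 b2
    have := h x y (by rw [hA.1, hA.2.1, hA.2.2]; ring) hr
    tauto
  · obtain ⟨x, y, hxy, hr⟩ := quad_root a0 a1 a2
    have e0 : a0 * (b0 * x ^ 2 + 2 * b1 * (x * y) + b2 * y ^ 2) = 0 := by
      linear_combination b0 * hr + 2 * (x * y) * k1 + y ^ 2 * k3
    have e1 : a1 * (b0 * x ^ 2 + 2 * b1 * (x * y) + b2 * y ^ 2) = 0 := by
      linear_combination b1 * hr - x ^ 2 * k1 + y ^ 2 * k2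
    have e2 : a2 * (b0 * x ^ 2 + 2 * b1 * (x * y) + b2 * y ^ 2) = 0 := by
      linear_combination b2 * hr - x ^ 2 * k3 - 2 * (x * y) * k2
    have hB : b0 * x ^ 2 + 2 * b1 * (x * y) + b2 * y ^ 2 = 0 := by
      by_contra hB
      exact hA ⟨(mul_eq_zero.1 e0).resolve_right hB, (mul_eq_zero.1 e1).resolve_right hB,
        (mul_eq_zero.1 e2).resolve_right hB⟩
    have := h x y hr hB
    tauto

/-- Linear change of variables given by an invertible matrix. -/
noncomputable def linHom (N : Matrix (Fin 4) (Fin 4) ℂ) :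
    MvPolynomial (Fin 4) ℂ →ₐ[ℂ] MvPolynomial (Fin 4) ℂ :=
  aeval (fun i => ∑ l, X l * C (N l i))

theorem linHom_comp (N M : Matrix (Fin 4) (Fin 4) ℂ) (h : M * N = 1) :
    (linHom M).comp (linHom N) = AlgHom.id ℂ _ := by
  apply MvPolynomial.algHom_ext
  intro i
  have hC : ∀ c : ℂ, linHom M (C c) = C c := fun c => (linHom M).commutes c
  simp only [AlgHom.comp_apply, AlgHom.id_apply]
  have hX : ∀ (N : Matrix (Fin 4) (Fin 4) ℂ) i, linHom N (X i) = ∑ l, X l * C (N l i) :=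
    fun N i => by rw [linHom, aeval_X]
  rw [hX, map_sum]
  simp only [map_mul, hC, hX, Finset.sum_mul]
  rw [Finset.sum_comm]
  have : ∀ l : Fin 4, ∑ j, (X l : MvPolynomial (Fin 4) ℂ) * C (M l j) * C (N j i) = X l * C ((1 : Matrix (Fin 4) (Fin 4) ℂ) l i) := by
    intro l
    rw [← h, Matrix.mul_apply, map_sum, Finset.mul_sum]
    refine Finset.sum_congr rfl fun j _ => ?_
    rw [C_mul]; ring
  simp only [this, Matrix.one_apply]
  rw [Finset.sum_eq_single i] <;> simp +contextual

noncomputable def linEquiv (N M : Matrix (Fin 4) (Fin 4) ℂ) (h : M * N = 1) (h' : N * M = 1) :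
    MvPolynomial (Fin 4) ℂ ≃ₐ[ℂ] MvPolynomial (Fin 4) ℂ :=
  AlgEquiv.ofAlgHom (linHom N) (linHom M) (linHom_comp M N h') (linHom_comp N M h)

theorem linHom_triForm (N : Matrix (Fin 4) (Fin 4) ℂ) (τ : Fin 4 → Fin 4 → Fin 4 → ℂ) :
    linHom N (triForm (fun i j k => C (τ i j k)) X X X) =
      ∑ l, ∑ m, ∑ n, monomial (Finsupp.single l 1 + Finsupp.single m 1 + Finsupp.single n 1)
        (triForm τ (N l) (N m) (N n)) := by
  have hC : ∀ c : ℂ, linHom N (C c) = C c := fun c => (linHom N).commutes c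
  have hX : ∀ i, linHom N (X i) = ∑ l, X l * C (N l i) := fun i => by rw [linHom, aeval_X]
  have h := triForm_map (linHom N).toRingHom (fun i j k => C (τ i j k)) X X X
  simp only [AlgHom.toRingHom_eq_coe, RingHom.coe_coe, hC, hX] at h
  rw [h, triForm_sum₁]
  refine Finset.sum_congr rfl fun l _ => ?_
  rw [triForm_sum₂, Finset.mul_sum]
  refine Finset.sum_congr rfl fun m _ => ?_
  rw [triForm_sum₃, Finset.mul_sum, Finset.mul_sum]
  refine Finset.sum_congr rfl fun n _ => ?_
  rw [← triForm_map C τ (N l) (N m) (N n)]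
  have : ∀ c : ℂ, (monomial (Finsupp.single l 1 + Finsupp.single m 1 + Finsupp.single n 1) c
      : MvPolynomial (Fin 4) ℂ) = X l * X m * X n * C c := by
    intro c
    simp only [X, C_apply, monomial_mul, one_mul, add_zero]
  rw [this]
  ring

theorem exps_eq (l m n : Fin 4) :
    (Finsupp.single l 1 + Finsupp.single m 1 + Finsupp.single n 1 : Fin 4 →₀ ℕ) =
      Finsupp.single 0 1 + Finsupp.single 1 1 + Finsupp.single 2 1 ↔
    (l = 0 ∧ m = 1 ∧ n = 2) ∨ (l = 0 ∧ m = 2 ∧ n = 1) ∨ (l = 1 ∧ m = 0 ∧ n = 2) ∨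
    (l = 1 ∧ m = 2 ∧ n = 0) ∨ (l = 2 ∧ m = 0 ∧ n = 1) ∨ (l = 2 ∧ m = 1 ∧ n = 0) := by
  rw [Finsupp.ext_iff]
  simp only [Finsupp.add_apply, Finsupp.single_apply]
  revert l m n
  decide

set_option synthInstance.maxHeartbeats 400000 in
set_option synthInstance.maxSize 4000 in
theorem leading_of_tensor (σ : Fin 4 → Fin 4 → Fin 4 → ℂ) (h1 : ∀ i j k, σ i j k = σ j i k)
    (h2 : ∀ i j k, σ i j k = σ i k j) (h000 : σ 0 0 0 = 0) (h001 : σ 0 0 1 = 0)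
    (h011 : σ 0 1 1 = 0) (h111 : σ 1 1 1 = 0) (h002 : σ 0 0 2 = 0) (h012 : σ 0 1 2 ≠ 0) :
    IsLeadingMonomial (DegRevLexLT (id : Fin 4 → Fin 4))
      (∑ l, ∑ m, ∑ n, monomial (Finsupp.single l 1 + Finsupp.single m 1 + Finsupp.single n 1)
        (σ l m n))
      (Finsupp.single 0 1 + Finsupp.single 1 1 + Finsupp.single 2 1) := by
  constructor
  · rw [mem_support_iff]
    simp only [coeff_sum, coeff_monomial, exps_eq]
    have e1 : σ 0 2 1 = σ 0 1 2 := h2 _ _ _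
    have e2 : σ 1 0 2 = σ 0 1 2 := h1 _ _ _
    have e3 : σ 1 2 0 = σ 0 1 2 := by rw [h2, h1]
    have e4 : σ 2 0 1 = σ 0 1 2 := by rw [h1, h2]
    have e5 : σ 2 1 0 = σ 0 1 2 := by rw [h2, h1, h2]
    simp [Fin.sum_univ_four, e1, e2, e3, e4, e5]
    intro h
    apply h012
    linear_combination h / 6
  · intro e he hne
    have : ∃ l m n, σ l m n ≠ 0 ∧ e = Finsupp.single l 1 + Finsupp.single m 1 + Finsupp.single n 1 := by
      by_contra! hc
      apply mem_support_iff.1 he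
      simp only [coeff_sum, coeff_monomial]
      refine Finset.sum_eq_zero fun l _ => Finset.sum_eq_zero fun m _ => Finset.sum_eq_zero fun n _ => ?_
      split_ifs with hh
      · by_contra h0
        exact hc l m n h0 hh.symm
      · rfl
    obtain ⟨l, m, n, hs, rfl⟩ := this
    have g1 : σ 0 1 0 = 0 := by rw [h2, h001]
    have g2 : σ 1 0 0 = 0 := by rw [h1, g1]
    have g3 : σ 1 0 1 = 0 := by rw [h1, h011]
    have g4 : σ 1 1 0 = 0 := by rw [h2, g3]
    have g5 : σ 0 2 0 = 0 := by rw [h2, h002]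
    have g6 : σ 2 0 0 = 0 := by rw [h1, g5]
    have hex : ¬ ((l, m, n) ∈ ([(0,0,0),(0,0,1),(0,1,0),(1,0,0),(0,1,1),(1,0,1),(1,1,0),(1,1,1),
        (0,0,2),(0,2,0),(2,0,0)] : List (Fin 4 × Fin 4 × Fin 4))) := by
      intro hmem
      simp only [List.mem_cons, Prod.mk.injEq, List.not_mem_nil, or_false] at hmem
      rcases hmem with ⟨rfl, rfl, rfl⟩ | ⟨rfl, rfl, rfl⟩ | ⟨rfl, rfl, rfl⟩ | ⟨rfl, rfl, rfl⟩ |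
        ⟨rfl, rfl, rfl⟩ | ⟨rfl, rfl, rfl⟩ | ⟨rfl, rfl, rfl⟩ | ⟨rfl, rfl, rfl⟩ |
        ⟨rfl, rfl, rfl⟩ | ⟨rfl, rfl, rfl⟩ | ⟨rfl, rfl, rfl⟩ <;> contradiction
    rw [Ne, exps_eq] at hne
    clear g1 g2 g3 g4 g5 g6 hs he h1 h2 h000 h001 h011 h111 h002 h012
    right
    simp only [Finsupp.add_apply, Finsupp.single_apply, id]
    revert l m n
    decide
/-- if `f ∈ ℂ[X₀,X₁,X₂,X₃]` is homogeneous of degree 3 and defines a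
nonsingular cubic surface in `ℙ³` (its partial derivatives only vanish simultaneously at
the origin), then there is a `ℂ`-algebra automorphism `φ` given by an invertible linear
change of variables such that the leading monomial of `φ f` with respect to degrevlex
with `X₀ > X₁ > X₂ > X₃` is `X₀X₁X₂` (a squarefree monomial). -/
theorem statement1 (f : MvPolynomial (Fin 4) ℂ) (hfhom : f.IsHomogeneous 3)
    (hsmooth : ∀ a : Fin 4 → ℂ,
      (∀ i, MvPolynomial.eval a (MvPolynomial.pderiv i f) = 0) → a = 0) :
    ∃ φ : MvPolynomial (Fin 4) ℂ ≃ₐ[ℂ] MvPolynomial (Fin 4) ℂ,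
      (∀ i, (φ (X i)).IsHomogeneous 1) ∧
      IsLeadingMonomial (DegRevLexLT (id : Fin 4 → Fin 4)) (φ f)
        (Finsupp.single 0 1 + Finsupp.single 1 1 + Finsupp.single 2 1) := by
  obtain ⟨τ, h1, h2, hf, hpd⟩ := exists_tensor f hfhom
  obtain ⟨a, b, hli, hab⟩ := exists_line τ h1 h2
  -- the trilinear form vanishes on the line
  have hexp : ∀ x y : ℂ, x ^ 3 * triForm τ a a a + x ^ 2 * y * (3 * triForm τ a a b) +
      x * y ^ 2 * (3 * triForm τ a b b) + y ^ 3 * triForm τ b b b = 0 := by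
    intro x y; rw [← triForm_cubic τ h1 h2, hab]
  have taaa : triForm τ a a a = 0 := by linear_combination hexp 1 0
  have tbbb : triForm τ b b b = 0 := by linear_combination hexp 0 1
  have taab : triForm τ a a b = 0 := by
    linear_combination (hexp 1 1 - hexp 1 (-1) - 2 * hexp 0 1) / 6
  have tabb : triForm τ a b b = 0 := by
    linear_combination (hexp 1 1 + hexp 1 (-1) - 2 * hexp 1 0) / 6
  have taba : triForm τ a b a = 0 := by rw [triForm_swap₂₃ τ h2, taab]
  have tbaa : triForm τ b a a = 0 := by rw [triForm_swap₁₂ τ h1, taba]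
  have tbab : triForm τ b a b = 0 := by rw [triForm_swap₁₂ τ h1, tabb]
  have tbba : triForm τ b b a = 0 := by rw [triForm_swap₂₃ τ h2, tbab]
  have tbac : ∀ c, triForm τ b a c = triForm τ a b c := fun c => triForm_swap₁₂ τ h1 b a c
  -- complete to a basis
  obtain ⟨d, hd⟩ := exists_linearIndependent_cons_of_lt_finrank (R := ℂ) (v := ![a, b])
    hli (by simp)
  obtain ⟨c, hc⟩ := exists_linearIndependent_cons_of_lt_finrank (R := ℂ) (v := Fin.cons d ![a, b])
    hd (by simp)
  let M0 : Matrix (Fin 4) (Fin 4) ℂ := Matrix.of ![c, d, a, b]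
  have hM0 : IsUnit M0.det := by
    rw [← Matrix.isUnit_iff_isUnit_det, ← Matrix.linearIndependent_rows_iff_isUnit]
    exact hc
  -- no common zeros
  have hnz : ∀ x y : ℂ, triForm τ a a c * x ^ 2 + 2 * triForm τ a b c * (x * y) +
        triForm τ b b c * y ^ 2 = 0 →
      triForm τ a a d * x ^ 2 + 2 * triForm τ a b d * (x * y) +
        triForm τ b b d * y ^ 2 = 0 → x = 0 ∧ y = 0 := by
    intro x y hA hB
    have hw : x • a + y • b = 0 := by
      set w := x • a + y • b with hwdef
      let g : Fin 4 → ℂ := fun k => ∑ i, ∑ j, τ i j k * w i * w j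
      have hg : ∀ v, triForm τ w w v = ∑ k, v k * g k := by
        intro v
        simp only [triForm, g, Finset.mul_sum]
        refine (Finset.sum_comm.trans (Finset.sum_congr rfl fun i _ => Finset.sum_comm.trans
          (Finset.sum_congr rfl fun j _ => Finset.sum_congr rfl fun k _ => ?_))).symm
        ring
      have hM : M0.mulVec g = 0 := by
        funext i
        have : ∀ v, triForm τ w w v = x ^ 2 * triForm τ a a v + 2 * (x * y) * triForm τ a b v +
            y ^ 2 * triForm τ b b v := by
          intro v
          simp only [hwdef, triForm_lin₁, triForm_lin₂, tbac]; ring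
        have hz : ∀ v, triForm τ w w v = 0 → ∑ k, v k * g k = 0 := fun v hv => by rw [← hg, hv]
        fin_cases i
        · exact hz c (by rw [this]; linear_combination hA)
        · exact hz d (by rw [this]; linear_combination hB)
        · exact hz a (by rw [this, taaa, taba, tbba]; ring)
        · exact hz b (by rw [this, taab, tabb, tbbb]; ring)
      have hg0 : g = 0 := Matrix.eq_zero_of_mulVec_eq_zero hM0.ne_zero hM
      apply hsmooth
      intro i
      rw [hpd]
      have := congrFun hg0 i
      simp only [g, Pi.zero_apply] at this
      simp only [map_mul, map_sum, eval_C, eval_X]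
      have e : ∑ j, ∑ k, τ i j k * w j * w k = 0 := by
        rw [← this]
        refine Finset.sum_congr rfl fun j _ => Finset.sum_congr rfl fun k _ => ?_
        rw [h1 i j k, h2 j i k]
      rw [e, mul_zero]
    exact LinearIndependent.pair_iff.1 hli x y hw
  obtain ⟨x0, y0, x1, y1, s, t, s', t', hd1, hd2, hroot, hpol⟩ := pencil _ _ _ _ _ _ hnz
  let Q : Matrix (Fin 4) (Fin 4) ℂ := !![0, 0, x0, y0; 0, 0, x1, y1; s, t, 0, 0; s', t', 0, 0]
  have hQ : Q.det ≠ 0 := by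
    have : Q.det = (x0 * y1 - y0 * x1) * (s * t' - t * s') := by
      simp [Q, Matrix.det_succ_row_zero, Fin.sum_univ_succ, Fin.succAbove]
      ring
    rw [this]
    exact mul_ne_zero hd1 hd2
  let N : Matrix (Fin 4) (Fin 4) ℂ := Q * M0
  have hN : IsUnit N.det := by
    rw [Matrix.det_mul]; exact (isUnit_iff_ne_zero.2 hQ).mul hM0
  have N0 : N 0 = x0 • a + y0 • b := by
    funext i; simp [N, Q, M0, Matrix.mul_apply, Fin.sum_univ_four]
  have N1 : N 1 = x1 • a + y1 • b := by
    funext i; simp [N, Q, M0, Matrix.mul_apply, Fin.sum_univ_four]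
  have N2 : N 2 = s • c + t • d := by
    funext i; simp [N, Q, M0, Matrix.mul_apply, Fin.sum_univ_four]
  refine ⟨linEquiv N N⁻¹ (Matrix.nonsing_inv_mul N hN) (Matrix.mul_nonsing_inv N hN), ?_, ?_⟩
  · intro i
    change (linHom N (X i)).IsHomogeneous 1
    rw [linHom, aeval_X]
    refine IsHomogeneous.sum _ _ _ fun l _ => ?_
    exact (isHomogeneous_X ℂ l).mul (isHomogeneous_C _ (N l i))
  · change IsLeadingMonomial _ (linHom N f) _
    rw [hf, linHom_triForm]
    apply leading_of_tensor
    · intro i j k; exact triForm_swap₁₂ τ h1 _ _ _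
    · intro i j k; exact triForm_swap₂₃ τ h2 _ _ _
    · rw [N0]; simp only [triForm_lin₁, triForm_lin₂, triForm_lin₃, taaa, taab, taba, tbaa, tabb, tbab, tbba, tbbb]; ring
    · rw [N0, N1]; simp only [triForm_lin₁, triForm_lin₂, triForm_lin₃, taaa, taab, taba, tbaa, tabb, tbab, tbba, tbbb]; ring
    · rw [N0, N1]; simp only [triForm_lin₁, triForm_lin₂, triForm_lin₃, taaa, taab, taba, tbaa, tabb, tbab, tbba, tbbb]; ring
    · rw [N1]; simp only [triForm_lin₁, triForm_lin₂, triForm_lin₃, taaa, taab, taba, tbaa, tabb, tbab, tbba, tbbb]; ring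
    · rw [N0, N2]; simp only [triForm_lin₁, triForm_lin₂, triForm_lin₃, tbac]; linear_combination hroot
    · rw [N0, N1, N2]; simp only [triForm_lin₁, triForm_lin₂, triForm_lin₃, tbac]
      intro h; apply hpol; linear_combination h
end

section
/- Let R be an ℕ-graded ring which is a finitely generated algebra over a field k = R₀ of prime characteristic p, and let W be a ℤ-graded R-module which is Artinian as an R-module, equipped with a Frobenius action F : W → W (an additive map with F(r w) = r^p F(w) for all r ∈ R, w ∈ W) which is graded in the sense that F(W_d) ⊆ W_{pd} for all d ∈ ℤ. Then there exist a natural number n and a chain of graded F-stable R-submodules 0 = L₀ ⊆ N₀ ⊆ L₁ ⊆ N₁ ⊆ ⋯ ⊆ L_n ⊆ N_n = W such that: (a) for each 1 ≤ i ≤ n, the only F-stable submodules P with N_{i−1} ⊆ P ⊆ L_i are N_{i−1} and L_i, and F(L_i) is not contained in N_{i−1} (i.e., each layer L_i/N_{i−1} is a simple module with Frobenius action whose induced Frobenius action is nontrivial); (b) for each 0 ≤ i ≤ n there exists e ∈ ℕ with F^e(N_i) ⊆ L_i (i.e., the induced Frobenius action on each layer N_i/L_i is nilpotent). -/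
namespace GrLyu
open DirectSum

section pr
variable {k : Type*} [Field k] {W : Type*} [AddCommGroup W] [Module k W]
  (ℳ : ℤ → Submodule k W) [DirectSum.Decomposition ℳ]

/-- projection to the degree `d` component -/
def pr (d : ℤ) : W →+ W where
  toFun w := ((DirectSum.decompose ℳ w d : ℳ d) : W)
  map_zero' := by simp
  map_add' a b := by simp [DirectSum.decompose_add]

lemma pr_mem (d : ℤ) (w : W) : pr ℳ d w ∈ ℳ d := (DirectSum.decompose ℳ w d).2

lemma pr_same {d : ℤ} {w : W} (h : w ∈ ℳ d) : pr ℳ d w = w :=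
  DirectSum.decompose_of_mem_same ℳ h

lemma pr_ne {d e : ℤ} {w : W} (h : w ∈ ℳ d) (hde : d ≠ e) : pr ℳ e w = 0 :=
  DirectSum.decompose_of_mem_ne ℳ h hde

lemma pr_smul (d : ℤ) (c : k) (w : W) : pr ℳ d (c • w) = c • pr ℳ d w := by
  change ((DirectSum.decompose ℳ (c • w) d : ℳ d) : W) = _
  rw [DirectSum.decompose_smul]
  rfl

lemma mem_of_pr (S : AddSubgroup W) (w : W) (h : ∀ d, pr ℳ d w ∈ S) : w ∈ S := by
  classical
  rw [← DirectSum.sum_support_decompose ℳ w]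
  exact sum_mem fun d _ => h d

lemma eq_zero_of_pr (w : W) (h : ∀ d, pr ℳ d w = 0) : w = 0 := by
  have := mem_of_pr ℳ ⊥ w (by simpa using h)
  simpa using this

lemma pr_map (f : W →+ W) (φ : ℤ → ℤ) (hφ : Function.Injective φ)
    (hf : ∀ d, ∀ w ∈ ℳ d, f w ∈ ℳ (φ d)) (d : ℤ) (w : W) :
    pr ℳ (φ d) (f w) = f (pr ℳ d w) := by
  induction w using DirectSum.Decomposition.inductionOn ℳ with
  | zero => simp
  | @homogeneous i m =>
    by_cases h : i = d
    · subst h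
      rw [pr_same ℳ (hf _ _ m.2), pr_same ℳ m.2]
    · rw [pr_ne ℳ (hf _ _ m.2) (fun h' => h (hφ h')), pr_ne ℳ m.2 h, map_zero]
  | add a b ha hb => simp only [map_add, ha, hb]

lemma pr_map_zero (f : W →+ W) (φ : ℤ → ℤ)
    (hf : ∀ d, ∀ w ∈ ℳ d, f w ∈ ℳ (φ d)) (e : ℤ) (he : ∀ d, φ d ≠ e) (w : W) :
    pr ℳ e (f w) = 0 := by
  induction w using DirectSum.Decomposition.inductionOn ℳ with
  | zero => simp
  | @homogeneous i m => exact pr_ne ℳ (hf _ _ m.2) (he i)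
  | add a b ha hb => simp only [map_add, ha, hb, add_zero]

lemma exists_lower (w : W) : ∃ n : ℤ, ∀ i < n, pr ℳ i w = 0 := by
  induction w using DirectSum.Decomposition.inductionOn ℳ with
  | zero => exact ⟨0, by simp⟩
  | @homogeneous i m => exact ⟨i, fun j hj => pr_ne ℳ m.2 (by omega)⟩
  | add a b ha hb =>
    obtain ⟨n, hn⟩ := ha
    obtain ⟨m, hm⟩ := hb
    refine ⟨min n m, fun i hi => ?_⟩
    rw [map_add, hn i (by omega), hm i (by omega), add_zero]

end pr

section main
variable {k : Type*} [Field k] {p : ℕ}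
    {R : Type*} [CommRing R] [Algebra k R]
    (𝒜 : ℕ → Submodule k R) [GradedAlgebra 𝒜]
    {W : Type*} [AddCommGroup W] [Module R W] [Module k W] [IsScalarTower k R W]
    (ℳ : ℤ → Submodule k W) [DirectSum.Decomposition ℳ]

lemma smul_of_homog (S : AddSubgroup W) (w : W)
    (h : ∀ i, ∀ r ∈ 𝒜 i, r • w ∈ S) (r : R) : r • w ∈ S := by
  induction r using DirectSum.Decomposition.inductionOn 𝒜 with
  | zero => simp
  | @homogeneous i m => exact h _ _ m.2
  | add a b ha hb => rw [add_smul]; exact add_mem ha hb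

lemma pr_rsmul (hg : ∀ (i : ℕ) (j : ℤ), ∀ r ∈ 𝒜 i, ∀ w ∈ ℳ j, r • w ∈ ℳ ((i : ℤ) + j))
    {i : ℕ} {r : R} (hr : r ∈ 𝒜 i) (d : ℤ) (w : W) :
    pr ℳ d (r • w) = r • pr ℳ (d - i) w := by
  have := pr_map ℳ (DistribSMul.toAddMonoidHom W r) (fun j => (i : ℤ) + j)
    (add_right_injective _) (fun j w hw => hg i j r hr w hw) (d - i) w
  simpa using this

/-- components below `m` vanish, and the component at `m` lies in `V` -/
def GV (h0 : 𝒜 0 = Submodule.span k {1})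
    (hg : ∀ (i : ℕ) (j : ℤ), ∀ r ∈ 𝒜 i, ∀ w ∈ ℳ j, r • w ∈ ℳ ((i : ℤ) + j))
    (m : ℤ) (V : Submodule k W) : Submodule R W where
  carrier := {w | (∀ i < m, pr ℳ i w = 0) ∧ pr ℳ m w ∈ V}
  zero_mem' := by simp
  add_mem' {a b} ha hb := by
    refine ⟨fun i hi => ?_, ?_⟩
    · rw [map_add, ha.1 i hi, hb.1 i hi, add_zero]
    · rw [map_add]; exact add_mem ha.2 hb.2
  smul_mem' r w hw := by
    refine smul_of_homog 𝒜
      { carrier := {w | (∀ i < m, pr ℳ i w = 0) ∧ pr ℳ m w ∈ V}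
        zero_mem' := by simp
        add_mem' := ?_
        neg_mem' := ?_ } w ?_ r
    · intro a b ha hb
      refine ⟨fun i hi => ?_, ?_⟩
      · rw [map_add, ha.1 i hi, hb.1 i hi, add_zero]
      · rw [map_add]; exact add_mem ha.2 hb.2
    · intro a ha
      refine ⟨fun i hi => ?_, ?_⟩
      · rw [map_neg, ha.1 i hi, neg_zero]
      · rw [map_neg]; exact neg_mem ha.2
    · intro i r hr
      refine ⟨fun j hj => ?_, ?_⟩
      · rw [pr_rsmul 𝒜 ℳ hg hr, hw.1 _ (by omega), smul_zero]
      · rw [pr_rsmul 𝒜 ℳ hg hr]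
        rcases Nat.eq_zero_or_pos i with rfl | hi
        · rw [h0, Submodule.mem_span_singleton] at hr
          obtain ⟨c, rfl⟩ := hr
          simpa using V.smul_mem c hw.2
        · rw [hw.1 _ (by omega), smul_zero]
          exact V.zero_mem

lemma findim_piece [IsArtinian R W] (h0 : 𝒜 0 = Submodule.span k {1})
    (hg : ∀ (i : ℕ) (j : ℤ), ∀ r ∈ 𝒜 i, ∀ w ∈ ℳ j, r • w ∈ ℳ ((i : ℤ) + j)) (m : ℤ) :
    FiniteDimensional k (ℳ m) := by
  have key : ∀ V V' : Submodule k (ℳ m),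
      GV 𝒜 ℳ h0 hg m (V.map (ℳ m).subtype) ≤ GV 𝒜 ℳ h0 hg m (V'.map (ℳ m).subtype) ↔
      V ≤ V' := by
    intro V V'
    constructor
    · intro h v hv
      have : (v : W) ∈ GV 𝒜 ℳ h0 hg m (V.map (ℳ m).subtype) := by
        refine ⟨fun i hi => pr_ne ℳ v.2 (by omega), ?_⟩
        rw [pr_same ℳ v.2]
        exact ⟨v, hv, rfl⟩
      have h2 := (h this).2
      rw [pr_same ℳ v.2] at h2
      obtain ⟨v', hv', e⟩ := h2
      have : v' = v := Subtype.ext e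
      exact this ▸ hv'
    · intro h w hw
      exact ⟨hw.1, Submodule.map_mono h hw.2⟩
  have hs : StrictMono (fun V : Submodule k (ℳ m) =>
      GV 𝒜 ℳ h0 hg m (V.map (ℳ m).subtype)) := by
    intro V V' h
    rw [lt_iff_le_not_ge] at h ⊢
    exact ⟨(key _ _).2 h.1, fun h' => h.2 ((key _ _).1 h')⟩
  have : IsArtinian k (ℳ m) := hs.wellFoundedLT
  exact (IsArtinianRing.tfae k (ℳ m) |>.out 2 0).1 this

lemma exists_top [IsArtinian R W] (h0 : 𝒜 0 = Submodule.span k {1})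
    (hg : ∀ (i : ℕ) (j : ℤ), ∀ r ∈ 𝒜 i, ∀ w ∈ ℳ j, r • w ∈ ℳ ((i : ℤ) + j)) :
    ∃ M : ℤ, ∀ d ≥ M, ∀ w, pr ℳ d w = 0 := by
  obtain ⟨n, hn⟩ := IsArtinian.monotone_stabilizes (R := R) (M := W)
    ⟨fun n : ℕ => OrderDual.toDual (GV 𝒜 ℳ h0 hg (n : ℤ) ⊤), by
      intro a b hab w hw
      exact ⟨fun i hi => hw.1 i (by omega), trivial⟩⟩
  refine ⟨n, fun d hd w => ?_⟩
  obtain ⟨d, rfl⟩ := Int.eq_ofNat_of_zero_le (by omega : 0 ≤ d)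
  have h1 : pr ℳ d w ∈ GV 𝒜 ℳ h0 hg (n : ℤ) ⊤ :=
    ⟨fun i hi => pr_ne ℳ (pr_mem ℳ _ _) (by omega), trivial⟩
  have h2 := hn (d + 1) (by omega)
  have h3 : GV 𝒜 ℳ h0 hg (n : ℤ) ⊤ = GV 𝒜 ℳ h0 hg ((d + 1 : ℕ) : ℤ) ⊤ :=
    congrArg OrderDual.ofDual h2
  rw [h3] at h1
  have := h1.1 d (by omega)
  rwa [pr_same ℳ (pr_mem ℳ _ _)] at this

lemma exists_E [IsArtinian R W] (h0 : 𝒜 0 = Submodule.span k {1})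
    (hg : ∀ (i : ℕ) (j : ℤ), ∀ r ∈ 𝒜 i, ∀ w ∈ ℳ j, r • w ∈ ℳ ((i : ℤ) + j)) (C : ℤ) :
    ∃ E : Submodule k W, FiniteDimensional k E ∧ ∀ d ≥ C, ℳ d ≤ E := by
  obtain ⟨M, hM⟩ := exists_top 𝒜 ℳ h0 hg
  have := fun m => findim_piece 𝒜 ℳ h0 hg m
  refine ⟨⨆ d : Finset.Icc C M, ℳ d, inferInstance, fun d hd w hw => ?_⟩
  by_cases h : d ≤ M
  · exact Submodule.mem_iSup_of_mem (⟨d, by simp; omega⟩ : Finset.Icc C M) hw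
  · rw [← pr_same ℳ hw, hM d (by omega)]
    exact zero_mem _

lemma exists_gens (hfg : Algebra.FiniteType k R) :
    ∃ (ι : Type) (_ : Fintype ι) (x : ι → R) (δ : ι → ℕ), (∀ i, x i ∈ 𝒜 (δ i)) ∧
      ∀ r : R, r ∈ Submodule.span k (Set.range fun a : ι → ℕ => ∏ i, x i ^ a i) := by
  classical
  obtain ⟨s, hs⟩ := hfg.1
  let T : Finset (ℕ × R) := s.biUnion fun r =>
    (DirectSum.decompose 𝒜 r).support.image fun i => (i, (DirectSum.decompose 𝒜 r i : R))
  let eq := T.equivFin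
  have hT : ∀ t : T, t.1.2 ∈ 𝒜 t.1.1 := by
    rintro ⟨⟨i, r⟩, ht⟩
    simp only [T, Finset.mem_biUnion, Finset.mem_image, Prod.mk.injEq] at ht
    obtain ⟨q, _, j, _, rfl, rfl⟩ := ht
    exact (DirectSum.decompose 𝒜 q j).2
  refine ⟨Fin T.card, inferInstance, fun i => (eq.symm i).1.2, fun i => (eq.symm i).1.1,
    fun i => hT _, fun r => ?_⟩
  have hadj : r ∈ Algebra.adjoin k (Set.range fun i => (eq.symm i).1.2) := by
    suffices h : (⊤ : Subalgebra k R) ≤ Algebra.adjoin k (Set.range fun i => (eq.symm i).1.2) from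
      h trivial
    rw [← hs, Algebra.adjoin_le_iff]
    intro r hr
    rw [SetLike.mem_coe, ← DirectSum.sum_support_decompose 𝒜 r]
    refine sum_mem fun i hi => Algebra.subset_adjoin ?_
    refine ⟨eq ⟨(i, (DirectSum.decompose 𝒜 r i : R)), ?_⟩, by simp⟩
    simp only [T, Finset.mem_biUnion, Finset.mem_image]
    exact ⟨r, hr, i, hi, rfl⟩
  rw [Algebra.adjoin_range_eq_range_aeval] at hadj
  obtain ⟨f, rfl⟩ := hadj
  change MvPolynomial.aeval _ f ∈ _
  rw [MvPolynomial.aeval_def, MvPolynomial.eval₂_eq']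
  refine sum_mem fun a _ => ?_
  rw [← Algebra.smul_def]
  exact Submodule.smul_mem _ _ (Submodule.subset_span ⟨a, rfl⟩)

/-- F-stable and graded -/
def Good (F : W →+ W) (N : Submodule R W) : Prop :=
  (∀ w ∈ N, F w ∈ N) ∧ ∀ w ∈ N, ∀ d, pr ℳ d w ∈ N

lemma exists_B [IsArtinian R W] (N : Submodule R W) :
    ∃ B : ℕ, ∀ w, w ∉ N → ∃ r : R, ∃ d : ℤ, -(B : ℤ) ≤ d ∧ pr ℳ d (r • w) ∉ N := by
  let X : ℕ → Submodule R W := fun B =>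
    { carrier := {w | ∀ r : R, ∀ d : ℤ, -(B : ℤ) ≤ d → pr ℳ d (r • w) ∈ N}
      zero_mem' := by simp
      add_mem' := fun {a b} ha hb r d hd => by
        rw [smul_add, map_add]; exact add_mem (ha r d hd) (hb r d hd)
      smul_mem' := fun s w hw r d hd => by
        rw [smul_smul]; exact hw _ d hd }
  obtain ⟨n, hn⟩ := IsArtinian.monotone_stabilizes (R := R) (M := W)
    ⟨fun n : ℕ => OrderDual.toDual (X n), by
      intro a b hab w hw r d hd
      exact hw r d (by omega)⟩
  refine ⟨n, fun w hw => ?_⟩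
  by_contra! hcon
  have h1 : w ∈ X n := fun r d hd => hcon r d hd
  apply hw
  refine mem_of_pr ℳ N.toAddSubgroup w fun d => ?_
  have h3 : X n = X (n + d.natAbs) := congrArg OrderDual.ofDual (hn (n + d.natAbs) (by omega))
  rw [h3] at h1
  have := h1 1 d (by omega)
  rwa [one_smul] at this

lemma iter_smul (F : W →+ W) (hF : ∀ (r : R) (w : W), F (r • w) = r ^ p • F w) (e : ℕ) (r : R)
    (w : W) : F^[e] (r • w) = r ^ p ^ e • F^[e] w := by
  induction e with
  | zero => simp
  | succ e ih => rw [Function.iterate_succ_apply', ih, hF, Function.iterate_succ_apply',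
      ← pow_mul, pow_succ]

lemma iter_add (F : W →+ W) (e : ℕ) (a b : W) : F^[e] (a + b) = F^[e] a + F^[e] b := by
  induction e with
  | zero => simp
  | succ e ih => simp only [Function.iterate_succ_apply', ih, map_add]

lemma iter_deg (F : W →+ W) (hFg : ∀ (d : ℤ), ∀ w ∈ ℳ d, F w ∈ ℳ ((p : ℤ) * d)) (e : ℕ)
    (d : ℤ) (w : W) (hw : w ∈ ℳ d) : F^[e] w ∈ ℳ ((p : ℤ) ^ e * d) := by
  induction e with
  | zero => simpa
  | succ e ih =>
    rw [Function.iterate_succ_apply', pow_succ', mul_assoc]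
    exact hFg _ _ ih

lemma iter_stable (F : W →+ W) (N : Submodule R W) (h : ∀ w ∈ N, F w ∈ N) (e : ℕ) (w : W)
    (hw : w ∈ N) : F^[e] w ∈ N := by
  induction e with
  | zero => simpa
  | succ e ih => rw [Function.iterate_succ_apply']; exact h _ ih

lemma monomial_mem (hg : ∀ (i : ℕ) (j : ℤ), ∀ r ∈ 𝒜 i, ∀ w ∈ ℳ j, r • w ∈ ℳ ((i : ℤ) + j))
    {ι : Type} [Fintype ι] (x : ι → R) (δ : ι → ℕ) (hx : ∀ i, x i ∈ 𝒜 (δ i)) (a : ι → ℕ)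
    (j : ℤ) (w : W) (hw : w ∈ ℳ j) :
    (∏ i, x i ^ a i) • w ∈ ℳ (((∑ i, a i * δ i : ℕ) : ℤ) + j) := by
  refine hg _ _ _ ?_ _ hw
  exact SetLike.prod_mem_graded 𝒜 _ _ fun i _ => SetLike.pow_mem_graded (a i) (hx i)

/-- The key lemma. -/
lemma key [IsArtinian R W] (hp : p.Prime) (hfg : Algebra.FiniteType k R)
    (hg : ∀ (i : ℕ) (j : ℤ), ∀ r ∈ 𝒜 i, ∀ w ∈ ℳ j, r • w ∈ ℳ ((i : ℤ) + j)) :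
    ∃ C : ℤ, ∀ (F : W →+ W), (∀ (r : R) (w : W), F (r • w) = r ^ p • F w) →
      (∀ (d : ℤ), ∀ w ∈ ℳ d, F w ∈ ℳ ((p : ℤ) * d)) →
      ∀ N : Submodule R W, ∃ e0 : ℕ, ∀ e ≥ e0, ∀ j, ∀ u ∈ ℳ j, F^[e] u ∉ N →
        ∃ r : R, ∃ d ≥ C, r • u ∈ ℳ d ∧ F^[e] (r • u) ∉ N := by
  obtain ⟨ι, _, x, δ, hx, hspan⟩ := exists_gens 𝒜 hfg
  refine ⟨-((∑ i, δ i : ℕ) : ℤ) - 1, fun F hF hFg N => ?_⟩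
  obtain ⟨B, hB⟩ := exists_B ℳ N
  refine ⟨B, fun e he j u hu hue => ?_⟩
  obtain ⟨r, d, hd, hr⟩ := hB _ hue
  have hFu := iter_deg ℳ F hFg e j u hu
  -- pass to a monomial
  obtain ⟨a, ha⟩ : ∃ a : ι → ℕ, pr ℳ d ((∏ i, x i ^ a i) • F^[e] u) ∉ N := by
    by_contra! hcon
    apply hr
    clear hr
    induction hspan r using Submodule.span_induction with
    | mem y hy => obtain ⟨a, rfl⟩ := hy; exact hcon a
    | zero => simp
    | add y z _ _ h1 h2 => rw [add_smul, map_add]; exact add_mem h1 h2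
    | smul c y _ h1 =>
      rw [smul_assoc, pr_smul, ← algebraMap_smul R c]
      exact N.smul_mem _ h1
  have hmon := monomial_mem 𝒜 ℳ hg x δ hx a _ _ hFu
  have hdeg : (((∑ i, a i * δ i : ℕ) : ℤ) + (p : ℤ) ^ e * j) = d := by
    by_contra hne
    exact ha (by rw [pr_ne ℳ hmon hne]; exact zero_mem _)
  rw [← hdeg, pr_same ℳ hmon] at ha
  have hq : B < p ^ e := lt_of_le_of_lt he (Nat.lt_pow_self hp.one_lt)
  have hqpos : 0 < p ^ e := by omega
  refine ⟨∏ i, x i ^ (a i / p ^ e), _, ?_, monomial_mem 𝒜 ℳ hg x δ hx _ _ _ hu, ?_⟩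
  · have h1 : ∑ i, a i * δ i ≤ p ^ e * (∑ i, (a i / p ^ e) * δ i) + p ^ e * ∑ i, δ i := by
      rw [Finset.mul_sum, Finset.mul_sum, ← Finset.sum_add_distrib]
      refine Finset.sum_le_sum fun i _ => ?_
      have h2 : a i ≤ p ^ e * (a i / p ^ e) + p ^ e := by
        have := Nat.div_add_mod (a i) (p ^ e)
        have := Nat.mod_lt (a i) hqpos
        omega
      calc a i * δ i ≤ (p ^ e * (a i / p ^ e) + p ^ e) * δ i := Nat.mul_le_mul_right _ h2
        _ = _ := by ring
    have h1' : ((∑ i, a i * δ i : ℕ) : ℤ) ≤ (p : ℤ) ^ e * ((∑ i, (a i / p ^ e) * δ i : ℕ) : ℤ)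
      + (p : ℤ) ^ e * ((∑ i, δ i : ℕ) : ℤ) := by exact_mod_cast h1
    have hq' : (B : ℤ) < (p : ℤ) ^ e := by exact_mod_cast hq
    generalize ((∑ i, a i * δ i : ℕ) : ℤ) = A at *
    generalize ((∑ i, (a i / p ^ e) * δ i : ℕ) : ℤ) = A' at *
    generalize ((∑ i, δ i : ℕ) : ℤ) = D at *
    generalize (p : ℤ) ^ e = q at *
    have : 0 < q := by omega
    nlinarith
  · intro hmem
    apply ha
    have : ∏ i, x i ^ a i = (∏ i, x i ^ (a i % p ^ e)) * (∏ i, x i ^ (a i / p ^ e)) ^ p ^ e := by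
      rw [← Finset.prod_pow, ← Finset.prod_mul_distrib]
      refine Finset.prod_congr rfl fun i _ => ?_
      rw [← pow_mul, ← pow_add, mul_comm, Nat.mod_add_div]
    rw [this, mul_smul, ← iter_smul F hF]
    exact N.smul_mem _ hmem

/-- iterated preimage -/
def Ker (F : W →+ W) (hF : ∀ (r : R) (w : W), F (r • w) = r ^ p • F w) (N : Submodule R W)
    (e : ℕ) : Submodule R W where
  carrier := {w | F^[e] w ∈ N}
  zero_mem' := by
    have : F^[e] 0 = 0 := Function.iterate_fixed (map_zero F) e
    simp [this]
  add_mem' {a b} ha hb := by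
    have := add_mem (S := Submodule R W) ha hb
    rwa [← iter_add] at this
  smul_mem' r w hw := by
    change F^[e] (r • w) ∈ N
    rw [iter_smul F hF]
    exact N.smul_mem _ hw

lemma Ker_mono (F : W →+ W) (hF : ∀ (r : R) (w : W), F (r • w) = r ^ p • F w) (N : Submodule R W)
    (hN : ∀ w ∈ N, F w ∈ N) : Monotone (Ker F hF N) := by
  intro a b hab w hw
  obtain ⟨c, rfl⟩ := Nat.exists_eq_add_of_le' hab
  change F^[c + a] w ∈ N
  rw [Function.iterate_add_apply]
  exact iter_stable F N hN _ _ hw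

lemma iter_pr (hp : p.Prime) (F : W →+ W) (hFg : ∀ (d : ℤ), ∀ w ∈ ℳ d, F w ∈ ℳ ((p : ℤ) * d))
    (e : ℕ) (d : ℤ) (w : W) : F^[e] (pr ℳ d w) = pr ℳ ((p : ℤ) ^ e * d) (F^[e] w) := by
  induction e with
  | zero => simp
  | succ e ih =>
    rw [Function.iterate_succ_apply', Function.iterate_succ_apply', ih, pow_succ', mul_assoc]
    exact (pr_map ℳ F (fun d => (p : ℤ) * d)
      (mul_right_injective₀ (by exact_mod_cast hp.ne_zero)) hFg _ _).symm

lemma Ker_good (hp : p.Prime) (F : W →+ W) (hF : ∀ (r : R) (w : W), F (r • w) = r ^ p • F w)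
    (hFg : ∀ (d : ℤ), ∀ w ∈ ℳ d, F w ∈ ℳ ((p : ℤ) * d)) (N : Submodule R W)
    (hN : Good ℳ F N) (e : ℕ) : Good ℳ F (Ker F hF N e) := by
  refine ⟨fun w hw => ?_, fun w hw d => ?_⟩
  · change F^[e] (F w) ∈ N
    rw [← Function.iterate_succ_apply, Function.iterate_succ_apply']
    exact hN.1 _ hw
  · change F^[e] (pr ℳ d w) ∈ N
    rw [iter_pr ℳ hp F hFg]
    exact hN.2 _ hw _

/-- Hartshorne–Speiser–Lyubeznik. -/
lemma hsl (hp : p.Prime) (F : W →+ W) (hF : ∀ (r : R) (w : W), F (r • w) = r ^ p • F w)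
    (hFg : ∀ (d : ℤ), ∀ w ∈ ℳ d, F w ∈ ℳ ((p : ℤ) * d)) (C : ℤ)
    (hC : ∀ N : Submodule R W, ∃ e0 : ℕ, ∀ e ≥ e0, ∀ j, ∀ u ∈ ℳ j, F^[e] u ∉ N →
        ∃ r : R, ∃ d ≥ C, r • u ∈ ℳ d ∧ F^[e] (r • u) ∉ N)
    (E : Submodule k W) [FiniteDimensional k E] (hE : ∀ d ≥ C, ℳ d ≤ E)
    (N : Submodule R W) (hN : Good ℳ F N) :
    ∃ e, ∀ e', Ker F hF N e' ≤ Ker F hF N e := by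
  obtain ⟨e0, he0⟩ := hC N
  have hmono := Ker_mono F hF N hN.1
  obtain ⟨n, hn⟩ := monotone_stabilizes_iff_noetherian.2 (inferInstance : IsNoetherian k E)
    ⟨fun e => ((Ker F hF N e).restrictScalars k).comap E.subtype, by
      intro a b hab w hw
      exact hmono hab hw⟩
  refine ⟨max e0 n, fun e' w hw => ?_⟩
  refine mem_of_pr ℳ (Ker F hF N (max e0 n)).toAddSubgroup w fun j => ?_
  by_contra hcon
  obtain ⟨r, d, hd, hrd, hr⟩ := he0 (max e0 n) (le_max_left _ _) j _ (pr_mem ℳ j w) hcon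
  apply hr
  have h1 : r • pr ℳ j w ∈ Ker F hF N (max n e') :=
    hmono (le_max_right _ _) (Submodule.smul_mem _ _ ((Ker_good ℳ hp F hF hFg N hN e').2 w hw j))
  have h2 := hn (max n e') (le_max_left _ _)
  have h3 : (⟨r • pr ℳ j w, hE d hd hrd⟩ : E) ∈
    ((Ker F hF N (max n e')).restrictScalars k).comap E.subtype := h1
  have h4 : (⟨r • pr ℳ j w, hE d hd hrd⟩ : E) ∈
    ((Ker F hF N n).restrictScalars k).comap E.subtype := by
    rw [show ((Ker F hF N n).restrictScalars k).comap E.subtype = _ from h2]; exact h3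
  exact hmono (le_max_right e0 n) (show r • pr ℳ j w ∈ Ker F hF N n from h4)

/-- the submodule of lowest degree forms of `P` modulo `N` -/
def In (hp : p.Prime)
    (hg : ∀ (i : ℕ) (j : ℤ), ∀ r ∈ 𝒜 i, ∀ w ∈ ℳ j, r • w ∈ ℳ ((i : ℤ) + j))
    (N P : Submodule R W) : Submodule R W :=
  let S : AddSubgroup W :=
    { carrier := {w | ∀ d, ∃ q ∈ P, (∀ i < d, pr ℳ i q ∈ N) ∧ pr ℳ d q - pr ℳ d w ∈ N}
      zero_mem' := fun d => ⟨0, zero_mem _, by simp, by simp⟩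
      add_mem' := by
        intro a b ha hb d
        obtain ⟨q, hq, h1, h2⟩ := ha d
        obtain ⟨q', hq', h1', h2'⟩ := hb d
        refine ⟨q + q', add_mem hq hq', fun i hi => ?_, ?_⟩
        · rw [map_add]; exact add_mem (h1 i hi) (h1' i hi)
        · rw [map_add, map_add, add_sub_add_comm]; exact add_mem h2 h2'
      neg_mem' := by
        intro a ha d
        obtain ⟨q, hq, h1, h2⟩ := ha d
        refine ⟨-q, neg_mem hq, fun i hi => ?_, ?_⟩
        · rw [map_neg]; exact neg_mem (h1 i hi)
        · rw [map_neg, map_neg, ← neg_sub']; exact neg_mem h2 }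
  { S with
    smul_mem' := fun r w hw => by
      refine smul_of_homog 𝒜 S w (fun i r hr d => ?_) r
      obtain ⟨q, hq, h1, h2⟩ := hw (d - i)
      refine ⟨r • q, P.smul_mem _ hq, fun j hj => ?_, ?_⟩
      · rw [pr_rsmul 𝒜 ℳ hg hr]; exact N.smul_mem _ (h1 _ (by omega))
      · rw [pr_rsmul 𝒜 ℳ hg hr, pr_rsmul 𝒜 ℳ hg hr, ← smul_sub]; exact N.smul_mem _ h2 }

lemma mem_In (hp : p.Prime)
    (hg : ∀ (i : ℕ) (j : ℤ), ∀ r ∈ 𝒜 i, ∀ w ∈ ℳ j, r • w ∈ ℳ ((i : ℤ) + j))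
    (N P : Submodule R W) (w : W) : w ∈ In 𝒜 ℳ hp hg N P ↔
    ∀ d, ∃ q ∈ P, (∀ i < d, pr ℳ i q ∈ N) ∧ pr ℳ d q - pr ℳ d w ∈ N := Iff.rfl

lemma In_good (hp : p.Prime)
    (hg : ∀ (i : ℕ) (j : ℤ), ∀ r ∈ 𝒜 i, ∀ w ∈ ℳ j, r • w ∈ ℳ ((i : ℤ) + j))
    (F : W →+ W) (hFg : ∀ (d : ℤ), ∀ w ∈ ℳ d, F w ∈ ℳ ((p : ℤ) * d))
    (N P : Submodule R W) (hN : Good ℳ F N) (hP : ∀ w ∈ P, F w ∈ P) :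
    Good ℳ F (In 𝒜 ℳ hp hg N P) := by
  have hp0 : (0 : ℤ) < p := by exact_mod_cast hp.pos
  have hm : ∀ d w, pr ℳ ((p : ℤ) * d) (F w) = F (pr ℳ d w) := fun d w =>
    pr_map ℳ F (fun d => (p : ℤ) * d) (mul_right_injective₀ hp0.ne') hFg d w
  have hz : ∀ e w, ¬ ((p : ℤ) ∣ e) → pr ℳ e (F w) = 0 := fun e w h =>
    pr_map_zero ℳ F (fun d => (p : ℤ) * d) hFg e (fun d hd => h ⟨d, hd.symm⟩) w
  refine ⟨fun w hw d => ?_, fun w hw d d' => ?_⟩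
  · by_cases hd : (p : ℤ) ∣ d
    · obtain ⟨j, rfl⟩ := hd
      obtain ⟨q, hq, h1, h2⟩ := hw j
      refine ⟨F q, hP _ hq, fun i hi => ?_, ?_⟩
      · by_cases hi' : (p : ℤ) ∣ i
        · obtain ⟨i, rfl⟩ := hi'
          rw [hm]
          exact hN.1 _ (h1 _ (lt_of_mul_lt_mul_left hi hp0.le))
        · rw [hz _ _ hi']; exact zero_mem _
      · rw [hm, hm, ← map_sub]; exact hN.1 _ h2
    · exact ⟨0, zero_mem _, by simp, by rw [hz _ _ hd]; simp⟩
  · by_cases hd : d = d'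
    · subst hd
      rw [pr_same ℳ (pr_mem ℳ _ _)]
      exact hw d
    · exact ⟨0, zero_mem _, by simp, by rw [pr_ne ℳ (pr_mem ℳ _ _) hd]; simp⟩

lemma simple_of_graded [IsArtinian R W] (hp : p.Prime) (h0 : 𝒜 0 = Submodule.span k {1})
    (hg : ∀ (i : ℕ) (j : ℤ), ∀ r ∈ 𝒜 i, ∀ w ∈ ℳ j, r • w ∈ ℳ ((i : ℤ) + j))
    (F : W →+ W) (hFg : ∀ (d : ℤ), ∀ w ∈ ℳ d, F w ∈ ℳ ((p : ℤ) * d))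
    (N L : Submodule R W) (hN : Good ℳ F N) (hL : Good ℳ F L) (hNL : N ≤ L)
    (hmin : ∀ Q : Submodule R W, Good ℳ F Q → N < Q → Q ≤ L → Q = L)
    (P : Submodule R W) (hP : ∀ w ∈ P, F w ∈ P) (hNP : N ≤ P) (hPL : P ≤ L) :
    P = N ∨ P = L := by
  classical
  by_cases hPN : P ≤ N
  · exact Or.inl (le_antisymm hPN hNP)
  right
  have hIL : In 𝒜 ℳ hp hg N P = L := by
    refine hmin _ (In_good 𝒜 ℳ hp hg F hFg N P hN hP) ?_ ?_
    · refine lt_of_le_not_ge (fun w hw d => ⟨0, zero_mem _, by simp, ?_⟩) fun hle => ?_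
      · rw [map_zero, zero_sub]; exact neg_mem (hN.2 _ hw _)
      · apply hPN
        intro q hq
        refine mem_of_pr ℳ N.toAddSubgroup q fun d => ?_
        obtain ⟨n, hn⟩ := exists_lower ℳ q
        -- strong induction on degree
        have : ∀ m : ℕ, ∀ i < n + m, pr ℳ i q ∈ N := by
          intro m
          induction m with
          | zero => intro i hi; rw [hn i (by simpa using hi)]; exact zero_mem _
          | succ m ih =>
            intro i hi
            by_cases him : i < n + m
            · exact ih i him
            · have hi' : i = n + m := by push_cast at hi; omega
              apply hle
              intro d'
              by_cases hd : i = d'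
              · subst hd
                refine ⟨q, hq, fun j hj => ih j (by omega), ?_⟩
                rw [pr_same ℳ (pr_mem ℳ _ _), sub_self]; exact zero_mem _
              · exact ⟨0, zero_mem _, by simp, by rw [pr_ne ℳ (pr_mem ℳ _ _) hd]; simp⟩
        exact this (d - n + 1).toNat d (by omega)
    · intro w hw
      refine mem_of_pr ℳ L.toAddSubgroup w fun d => ?_
      obtain ⟨q, hq, _, h2⟩ := hw d
      have := sub_mem (hL.2 _ (hPL hq) d) (hNL h2)
      rwa [sub_sub_cancel] at this
  refine le_antisymm hPL ?_
  obtain ⟨M, hM⟩ := exists_top 𝒜 ℳ h0 hg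
  have hdown : ∀ m : ℕ, ∀ w ∈ L, (∀ i < M - m, pr ℳ i w ∈ N) → w ∈ P := by
    intro m
    induction m with
    | zero =>
      intro w _ h
      apply hNP
      refine mem_of_pr ℳ N.toAddSubgroup w fun d => ?_
      by_cases hd : d < M
      · exact h d (by simpa using hd)
      · rw [hM d (by omega)]; exact zero_mem _
    | succ m ih =>
      intro w hw h
      have hw' := hw
      rw [← hIL] at hw'
      obtain ⟨q, hq, h1, h2⟩ := hw' (M - (m + 1 : ℕ))
      have : q - w ∈ P := by
        refine ih _ (sub_mem (hPL hq) hw) fun i hi => ?_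
        rw [map_sub]
        by_cases hi' : i < M - (m + 1 : ℕ)
        · exact sub_mem (h1 i hi') (h i hi')
        · have : i = M - (m + 1 : ℕ) := by push_cast at hi' ⊢; omega
          rw [this]; exact h2
      have := sub_mem hq this
      rwa [sub_sub_cancel] at this
  intro w hw
  obtain ⟨n, hn⟩ := exists_lower ℳ w
  refine hdown (M - n).toNat w hw fun i hi => ?_
  rw [hn i (by omega)]; exact zero_mem _

lemma chain [IsArtinian R W] (hp : p.Prime) (h0 : 𝒜 0 = Submodule.span k {1})
    (hg : ∀ (i : ℕ) (j : ℤ), ∀ r ∈ 𝒜 i, ∀ w ∈ ℳ j, r • w ∈ ℳ ((i : ℤ) + j))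
    (F : W →+ W) (hF : ∀ (r : R) (w : W), F (r • w) = r ^ p • F w)
    (hFg : ∀ (d : ℤ), ∀ w ∈ ℳ d, F w ∈ ℳ ((p : ℤ) * d)) (C : ℤ)
    (hC : ∀ N : Submodule R W, ∃ e0 : ℕ, ∀ e ≥ e0, ∀ j, ∀ u ∈ ℳ j, F^[e] u ∉ N →
        ∃ r : R, ∃ d ≥ C, r • u ∈ ℳ d ∧ F^[e] (r • u) ∉ N)
    (E : Submodule k W) [FiniteDimensional k E] (hE : ∀ d ≥ C, ℳ d ≤ E)
    (T : Submodule k E) : ∀ (L0 N0 : Submodule R W),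
    T = (N0.restrictScalars k).comap E.subtype →
    Good ℳ F L0 → Good ℳ F N0 → (∀ w, F w ∈ N0 → w ∈ N0) → L0 ≤ N0 →
    (∃ e : ℕ, ∀ w ∈ N0, F^[e] w ∈ L0) →
    ∃ (n : ℕ) (L N : ℕ → Submodule R W), L 0 = L0 ∧ N 0 = N0 ∧ N n = ⊤ ∧
      (∀ i ≤ n, L i ≤ N i) ∧ (∀ i < n, N i ≤ L (i + 1)) ∧
      (∀ i ≤ n, Good ℳ F (L i) ∧ Good ℳ F (N i)) ∧
      (∀ i < n,
        (∀ P : Submodule R W, (∀ w ∈ P, F w ∈ P) → N i ≤ P → P ≤ L (i + 1) →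
          P = N i ∨ P = L (i + 1)) ∧ ¬ (∀ w ∈ L (i + 1), F w ∈ N i)) ∧
      (∀ i ≤ n, ∃ e : ℕ, ∀ w ∈ N i, F^[e] w ∈ L i) := by
  induction T using WellFoundedGT.induction with
  | ind T IH =>
  intro L0 N0 hT hL0 hN0 hcl hle hnil
  by_cases htop : N0 = ⊤
  · refine ⟨0, fun _ => L0, fun _ => N0, rfl, rfl, htop, fun _ _ => hle, by simp,
      fun _ _ => ⟨hL0, hN0⟩, by simp, fun _ _ => hnil⟩
  have hgtop : Good ℳ F (⊤ : Submodule R W) := ⟨fun _ _ => trivial, fun _ _ _ => trivial⟩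
  obtain ⟨L1, ⟨hL1, hlt⟩, hmin⟩ := WellFounded.has_min
    (wellFounded_lt (α := Submodule R W)) {Q | Good ℳ F Q ∧ N0 < Q}
    ⟨⊤, hgtop, lt_top_iff_ne_top.2 htop⟩
  obtain ⟨e1, he1⟩ := hsl ℳ hp F hF hFg C hC E hE L1 hL1
  set N1 := Ker F hF L1 e1 with hN1def
  have hN1 : Good ℳ F N1 := Ker_good ℳ hp F hF hFg L1 hL1 e1
  have hL1N1 : L1 ≤ N1 := fun w hw => iter_stable F L1 hL1.1 e1 w hw
  have hcl1 : ∀ w, F w ∈ N1 → w ∈ N1 := fun w hw => he1 (e1 + 1) hw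
  have hcliter : ∀ e w, F^[e] w ∈ N0 → w ∈ N0 := by
    intro e
    induction e with
    | zero => intro w h; exact h
    | succ e ih => intro w h; exact hcl _ (ih _ h)
  have hTlt : (N1.restrictScalars k).comap E.subtype > T := by
    refine lt_of_le_not_ge ?_ fun hge => ?_
    · rw [hT]; intro w hw; exact hL1N1 (hlt.le hw)
    · refine (lt_of_lt_of_le hlt hL1N1).not_ge fun w hw => ?_
      refine mem_of_pr ℳ N0.toAddSubgroup w fun j => ?_
      by_contra hcon
      obtain ⟨e0, he0⟩ := hC N0
      obtain ⟨r, d, hd, hrd, hr⟩ := he0 e0 le_rfl j _ (pr_mem ℳ j w)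
        (fun h => hcon (hcliter _ _ h))
      apply hr
      apply iter_stable F N0 hN0.1
      have h3 : (⟨r • pr ℳ j w, hE d hd hrd⟩ : E) ∈ (N1.restrictScalars k).comap E.subtype :=
        show r • pr ℳ j w ∈ N1 from N1.smul_mem _ (hN1.2 _ hw _)
      have h4 := hge h3
      rw [hT] at h4
      exact h4
  obtain ⟨n, L, N, hL, hN, hn, c1, c2, c3, c4, c5⟩ :=
    IH _ hTlt L1 N1 rfl hL1 hN1 hcl1 hL1N1 ⟨e1, fun w hw => hw⟩
  refine ⟨n + 1, fun i => Nat.casesOn i L0 L, fun i => Nat.casesOn i N0 N, rfl, rfl, hn,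
    ?_, ?_, ?_, ?_, ?_⟩
  · rintro (_ | i) hi
    · exact hle
    · exact c1 i (by omega)
  · rintro (_ | i) hi
    · change N0 ≤ L 0
      rw [hL]; exact hlt.le
    · exact c2 i (by omega)
  · rintro (_ | i) hi
    · exact ⟨hL0, hN0⟩
    · exact c3 i (by omega)
  · rintro (_ | i) hi
    · change (∀ P : Submodule R W, (∀ w ∈ P, F w ∈ P) → N0 ≤ P → P ≤ L 0 →
          P = N0 ∨ P = L 0) ∧ ¬ (∀ w ∈ L 0, F w ∈ N0)
      rw [hL]
      refine ⟨fun P hP h1 h2 => simple_of_graded 𝒜 ℳ hp h0 hg F hFg N0 L1 hN0 hL1 hlt.le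
        (fun Q hQ hQ1 hQ2 => ?_) P hP h1 h2, fun h => hlt.not_ge fun w hw => hcl _ (h w hw)⟩
      by_contra hne
      exact hmin Q ⟨hQ, hQ1⟩ (lt_of_le_of_ne hQ2 hne)
    · exact c4 i (by omega)
  · rintro (_ | i) hi
    · exact hnil
    · exact c5 i (by omega)

end main
end GrLyu


/-- graded Lyubeznik filtration. Let `R` be an `ℕ`-graded ring, finitely
generated as an algebra over the field `k = R₀` of characteristic `p`, and let `W` be a
`ℤ`-graded Artinian `R`-module with a graded Frobenius action `F`. Then there is a chain
of graded `F`-stable submodules `0 = L₀ ⊆ N₀ ⊆ L₁ ⊆ ⋯ ⊆ Lₙ ⊆ Nₙ = W` whose layers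
`Lᵢ/Nᵢ₋₁` are simple with nontrivial Frobenius action and whose layers `Nᵢ/Lᵢ` have
nilpotent Frobenius action. -/
theorem statement3
    (k : Type*) [Field k] (p : ℕ) (hp : p.Prime) [CharP k p]
    (R : Type*) [CommRing R] [Algebra k R] (hfg : Algebra.FiniteType k R)
    (𝒜 : ℕ → Submodule k R) [GradedAlgebra 𝒜]
    (h𝒜₀ : 𝒜 0 = Submodule.span k {1})
    (W : Type*) [AddCommGroup W] [Module R W] [Module k W] [IsScalarTower k R W]
    [IsArtinian R W]
    (ℳ : ℤ → Submodule k W) [DirectSum.Decomposition ℳ]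
    (hgradedsmul : ∀ (i : ℕ) (j : ℤ), ∀ r ∈ 𝒜 i, ∀ w ∈ ℳ j, r • w ∈ ℳ ((i : ℤ) + j))
    (F : W → W) (hFadd : ∀ a b : W, F (a + b) = F a + F b)
    (hFsmul : ∀ (r : R) (w : W), F (r • w) = r ^ p • F w)
    (hFgraded : ∀ (d : ℤ), ∀ w ∈ ℳ d, F w ∈ ℳ ((p : ℤ) * d)) :
    ∃ (n : ℕ) (L N : ℕ → Submodule R W),
      -- the chain `0 = L₀ ⊆ N₀ ⊆ L₁ ⊆ N₁ ⊆ ⋯ ⊆ Lₙ ⊆ Nₙ = W`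
      L 0 = ⊥ ∧ N n = ⊤ ∧
      (∀ i ≤ n, L i ≤ N i) ∧ (∀ i < n, N i ≤ L (i + 1)) ∧
      -- each `L i` and `N i` is `F`-stable
      (∀ i ≤ n, (∀ w ∈ L i, F w ∈ L i) ∧ (∀ w ∈ N i, F w ∈ N i)) ∧
      -- each `L i` and `N i` is a graded submodule
      (∀ i ≤ n,
        (∀ w ∈ L i, ∀ d : ℤ, ((DirectSum.decompose ℳ w d : ℳ d) : W) ∈ L i) ∧
        (∀ w ∈ N i, ∀ d : ℤ, ((DirectSum.decompose ℳ w d : ℳ d) : W) ∈ N i)) ∧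
      -- (a) each layer `L i / N (i-1)` is simple with nontrivial Frobenius action
      (∀ i, 1 ≤ i → i ≤ n →
        (∀ P : Submodule R W, (∀ w ∈ P, F w ∈ P) → N (i - 1) ≤ P → P ≤ L i →
          P = N (i - 1) ∨ P = L i) ∧
        ¬ (∀ w ∈ L i, F w ∈ N (i - 1))) ∧
      -- (b) each layer `N i / L i` has nilpotent Frobenius action
      (∀ i ≤ n, ∃ e : ℕ, ∀ w ∈ N i, F^[e] w ∈ L i) := by
  obtain ⟨C, hC⟩ := GrLyu.key 𝒜 ℳ hp hfg hgradedsmul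
  obtain ⟨E, hEfin, hE⟩ := GrLyu.exists_E 𝒜 ℳ h𝒜₀ hgradedsmul C
  let F' : W →+ W := AddMonoidHom.mk' F hFadd
  have hC' := hC F' hFsmul hFgraded
  have hbot : GrLyu.Good ℳ F' (⊥ : Submodule R W) := by
    refine ⟨fun w hw => ?_, fun w hw d => ?_⟩ <;>
    · rw [Submodule.mem_bot] at hw ⊢
      rw [hw, map_zero]
  obtain ⟨e, he⟩ := GrLyu.hsl ℳ hp F' hFsmul hFgraded C hC' E hE ⊥ hbot
  obtain ⟨n, L, N, hL, hN, hn, c1, c2, c3, c4, c5⟩ :=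
    GrLyu.chain 𝒜 ℳ hp h𝒜₀ hgradedsmul F' hFsmul hFgraded C hC' E hE _ ⊥
      (GrLyu.Ker F' hFsmul ⊥ e) rfl hbot
      (GrLyu.Ker_good ℳ hp F' hFsmul hFgraded ⊥ hbot e) (fun w hw => he (e + 1) hw) bot_le
      ⟨e, fun w hw => hw⟩
  refine ⟨n, L, N, hL, hn, c1, c2, fun i hi => ⟨(c3 i hi).1.1, (c3 i hi).2.1⟩,
    fun i hi => ⟨(c3 i hi).1.2, (c3 i hi).2.2⟩, ?_, c5⟩
  rintro (_ | i) h1 h2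
  · omega
  · exact c4 i (by omega)
end

section
/- For every prime number p, the ring R = 𝔽_p[X,Y,Z,U,W]/(XY, XZ, Y(ZU − W²)) is not F-split. -/
open MvPolynomial

/-- A commutative ring `R` (of characteristic `p`) is `F`-split if there is an additive
map `φ : R → R` with `φ (r ^ p * s) = r * φ s` and `φ 1 = 1`, i.e. the Frobenius splits. -/
def IsFSplit (p : ℕ) (R : Type*) [CommRing R] : Prop :=
  ∃ φ : R →+ R, (∀ r s : R, φ (r ^ p * s) = r * φ s) ∧ φ 1 = 1

/-- for every prime `p`, the ring
`𝔽_p[X,Y,Z,U,W]/(XY, XZ, Y(ZU − W²))` is not `F`-split (here `X = X 0`, `Y = X 1`,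
`Z = X 2`, `U = X 3`, `W = X 4`). -/
theorem statement12 (p : ℕ) (hp : p.Prime) :
    ¬ IsFSplit p (MvPolynomial (Fin 5) (ZMod p) ⧸
        Ideal.span {(X 0 * X 1 : MvPolynomial (Fin 5) (ZMod p)),
          X 0 * X 2, X 1 * (X 2 * X 3 - X 4 ^ 2)}) := by
  rintro ⟨φ, h, h1⟩
  have : Fact p.Prime := ⟨hp⟩
  obtain ⟨n, rfl⟩ : ∃ n, p = n + 2 := ⟨p - 2, by have := hp.two_le; omega⟩
  generalize hI : Ideal.span {(X 0 * X 1 : MvPolynomial (Fin 5) (ZMod (n + 2))),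
          X 0 * X 2, X 1 * (X 2 * X 3 - X 4 ^ 2)} = I at φ h h1
  have mem : ∀ f, f ∈ I → ∃ u v w, f = u * (X 0 * X 1) + v * (X 0 * X 2)
      + w * (X 1 * (X 2 * X 3 - X 4 ^ 2)) := by
    intro f hf
    rw [← hI, Ideal.mem_span_insert] at hf
    obtain ⟨u, z, hz, rfl⟩ := hf
    rw [Ideal.mem_span_pair] at hz
    obtain ⟨v, w, rfl⟩ := hz
    exact ⟨u, v, w, by ring⟩
  have e1 : (X 0 * X 2 : MvPolynomial (Fin 5) (ZMod (n + 2))) ∈ I := by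
    rw [← hI]; exact Ideal.subset_span (by simp)
  have e2 : (X 1 * (X 2 * X 3 - X 4 ^ 2) : MvPolynomial (Fin 5) (ZMod (n + 2))) ∈ I := by
    rw [← hI]; exact Ideal.subset_span (by simp)
  have q1 := Ideal.Quotient.eq_zero_iff_mem.mpr e1
  have q2 := Ideal.Quotient.eq_zero_iff_mem.mpr e2
  simp only [map_mul, map_sub, map_pow] at q1 q2
  let x : Fin 5 → MvPolynomial (Fin 5) (ZMod (n + 2)) ⧸ I := fun i => Ideal.Quotient.mk I (X i)
  change x 0 * x 2 = 0 at q1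
  change x 1 * (x 2 * x 3 - x 4 ^ 2) = 0 at q2
  obtain ⟨a, ha⟩ := Ideal.Quotient.mk_surjective (φ (-(x 2 * x 3 - x 4 ^ 2) * x 4 ^ n))
  obtain ⟨b, hb⟩ := Ideal.Quotient.mk_surjective (φ (x 2 * x 3 * x 4 ^ n))
  have hab : X 4 - a - b ∈ I := by
    rw [← Ideal.Quotient.eq_zero_iff_mem, map_sub, map_sub, ha, hb, sub_sub, ← map_add]
    have := h (x 4) 1
    rw [h1, mul_one, mul_one] at this
    rw [sub_eq_zero]
    change x 4 = _
    refine this.symm.trans (congrArg φ ?_)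
    ring
  have haY : X 1 * a ∈ I := by
    rw [← Ideal.Quotient.eq_zero_iff_mem, map_mul, ha]
    change x 1 * _ = 0
    rw [← h, show x 1 ^ (n + 2) * (-(x 2 * x 3 - x 4 ^ 2) * x 4 ^ n)
      = -(x 1 ^ (n + 1) * x 4 ^ n) * (x 1 * (x 2 * x 3 - x 4 ^ 2)) by ring, q2, mul_zero, map_zero]
  have hbX : X 0 * b ∈ I := by
    rw [← Ideal.Quotient.eq_zero_iff_mem, map_mul, hb]
    change x 0 * _ = 0
    rw [← h, show x 0 ^ (n + 2) * (x 2 * x 3 * x 4 ^ n)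
      = (x 0 ^ (n + 1) * x 3 * x 4 ^ n) * (x 0 * x 2) by ring, q1, mul_zero, map_zero]
  let α : MvPolynomial (Fin 5) (ZMod (n + 2)) →ₐ[ZMod (n + 2)]
      MvPolynomial (Fin 5) (ZMod (n + 2)) := aeval ![0, X 1, X 2, X 3, X 4]
  let β : MvPolynomial (Fin 5) (ZMod (n + 2)) →ₐ[ZMod (n + 2)]
      MvPolynomial (Fin 5) (ZMod (n + 2)) := aeval ![X 0, 0, 0, X 3, X 4]
  let γ : MvPolynomial (Fin 5) (ZMod (n + 2)) →ₐ[ZMod (n + 2)] Polynomial (ZMod (n + 2)) := aeval ![0, 0, 0, 0, Polynomial.X]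
  have hγα : ∀ f, γ (α f) = γ f := by
    intro f
    have : γ.comp α = γ := by
      ext i : 1
      fin_cases i <;> simp [α, γ]
    exact DFunLike.congr_fun this f
  have hγβ : ∀ f, γ (β f) = γ f := by
    intro f
    have : γ.comp β = γ := by
      ext i : 1
      fin_cases i <;> simp [β, γ]
    exact DFunLike.congr_fun this f
  obtain ⟨u, v, w, hA⟩ := mem _ haY
  obtain ⟨u', v', w', hB⟩ := mem _ hbX
  obtain ⟨u'', v'', w'', hC⟩ := mem _ hab
  have hA' : α a = α w * (X 2 * X 3 - X 4 ^ 2) := by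
    have := congrArg α hA
    simp [α] at this
    refine mul_left_cancel₀ (X_ne_zero (R := ZMod (n + 2)) (1 : Fin 5)) ?_
    refine Eq.trans (b := α w * (X 1 * (X 2 * X 3 - X 4 ^ 2))) this ?_
    ring
  have hB' : β b = 0 := by
    have := congrArg β hB
    simpa [β] using this
  have hA2 : γ a = γ w * (- Polynomial.X ^ 2) := by
    rw [← hγα a, hA', map_mul, hγα]
    simp [γ]
  have hB2 : γ b = 0 := by rw [← hγβ b, hB', map_zero]
  have hC2 := congrArg γ hC
  rw [map_sub, map_sub, hA2, hB2] at hC2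
  have hC3 : (Polynomial.X : Polynomial (ZMod (n + 2))) + γ w * Polynomial.X ^ 2 = 0 := by
    simpa [γ] using hC2
  have := congrArg (fun f => Polynomial.coeff f 1) hC3
  simp [Polynomial.coeff_mul_X_pow'] at this
end
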